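/- arXiv:1909.09918 — 8 statements merged into one kernel-verified Lean document; each statement's English description precedes it below -/
import Mathlib

section
/- For every integer d ≥ 1, every x ∈ ℝ^d and every real t with |t| < 1, the generating function G(x;t) = Σ_{M=0}^∞ ρ^{M,d}(x) t^M of the ground-state densities converges and satisfies (1 - t) G(x;t) = π^{-d/2} (1 - t²)^{-d/2} exp( - ‖x‖² (1 - t)/(1 + t) ). -/
open MeasureTheory Real

/-- Physicists' Hermite polynomials: `H 0 = 1`, `H 1 x = 2x`,
`H (n+2) x = 2x H (n+1) x - 2(n+1) H n x`. -/
noncomputable def hermiteH : ℕ → ℝ → ℝ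
  | 0 => fun _ => 1
  | 1 => fun x => 2 * x
  | (n + 2) => fun x => 2 * x * hermiteH (n + 1) x - 2 * (n + 1) * hermiteH n x

/-- Normalised harmonic oscillator eigenfunctions. -/
noncomputable def ψho (l : ℕ) (x : ℝ) : ℝ :=
  (Real.sqrt (2 ^ l * (Nat.factorial l) * Real.sqrt π))⁻¹ * hermiteH l x * Real.exp (-x ^ 2 / 2)

/-- Ground-state density of the `d`-dimensional harmonically trapped Fermi gas,
shell label `M`: sum over occupation arrays `l ∈ ℕ^d` with `l 1 + ⋯ + l d ≤ M`. -/
noncomputable def fermiDensity (d M : ℕ) (x : EuclideanSpace ℝ (Fin d)) : ℝ :=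
  ∑ l ∈ Finset.filter (fun l => ∑ j, l j ≤ M)
      (Fintype.piFinset fun _ : Fin d => Finset.range (M + 1)),
    ∏ j, (ψho (l j) (x j)) ^ 2

/-- Generalised Laguerre polynomial `L_n^{(α)}` with natural parameter `α`. -/
noncomputable def laguerreL (n α : ℕ) (x : ℝ) : ℝ :=
  ∑ k ∈ Finset.range (n + 1),
    (-1 : ℝ) ^ k * (Nat.choose (n + α) (n - k) : ℝ) * x ^ k / (Nat.factorial k : ℝ)

/-- `φ` converges absolutely at `t`, with sum `S`. -/
def SumsTo (t : ℝ) (φ : PowerSeries ℝ) (S : ℝ) : Prop :=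
  Summable (fun n => ‖PowerSeries.coeff n φ * t ^ n‖) ∧
    HasSum (fun n => PowerSeries.coeff n φ * t ^ n) S

lemma SumsTo.mk' {t : ℝ} {φ : PowerSeries ℝ}
    (h : Summable (fun n => ‖PowerSeries.coeff n φ * t ^ n‖)) :
    SumsTo t φ (∑' n, PowerSeries.coeff n φ * t ^ n) :=
  ⟨h, h.of_norm.hasSum⟩

lemma SumsTo.unique {t : ℝ} {φ : PowerSeries ℝ} {S T : ℝ} (h : SumsTo t φ S)
    (h' : SumsTo t φ T) : S = T := h.2.unique h'.2

lemma SumsTo.add {t : ℝ} {φ χ : PowerSeries ℝ} {S T : ℝ} (h : SumsTo t φ S)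
    (h' : SumsTo t χ T) : SumsTo t (φ + χ) (S + T) := by
  constructor
  · refine Summable.of_nonneg_of_le (fun _ => norm_nonneg _) (fun n => ?_) (h.1.add h'.1)
    rw [map_add, add_mul]
    exact norm_add_le _ _
  · simpa [add_mul] using h.2.add h'.2

lemma SumsTo.mul {t : ℝ} {φ χ : PowerSeries ℝ} {S T : ℝ} (h : SumsTo t φ S)
    (h' : SumsTo t χ T) : SumsTo t (φ * χ) (S * T) := by
  have e : ∀ n, PowerSeries.coeff n (φ * χ) * t ^ n =
      ∑ kl ∈ Finset.HasAntidiagonal.antidiagonal n, (PowerSeries.coeff kl.1 φ * t ^ kl.1) *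
        (PowerSeries.coeff kl.2 χ * t ^ kl.2) := by
    intro n
    rw [PowerSeries.coeff_mul, Finset.sum_mul]
    refine Finset.sum_congr rfl fun kl hkl => ?_
    rw [← Finset.HasAntidiagonal.mem_antidiagonal.1 hkl, pow_add]
    ring
  have h1 := summable_norm_sum_mul_antidiagonal_of_summable_norm h.1 h'.1
  have h2 := tsum_mul_tsum_eq_tsum_sum_antidiagonal_of_summable_norm h.1 h'.1
  simp_rw [← e] at h1 h2
  refine ⟨h1, ?_⟩
  rw [← h.2.tsum_eq, ← h'.2.tsum_eq, h2]
  exact h1.of_norm.hasSum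

lemma sumsTo_C (t c : ℝ) : SumsTo t (PowerSeries.C c) c := by
  have h0 : ∀ n, n ≠ 0 → PowerSeries.coeff n (PowerSeries.C c) * t ^ n = 0 := by
    intro n hn
    simp [PowerSeries.coeff_C, hn]
  refine ⟨summable_of_ne_finset_zero (s := {0}) ?_, ?_⟩
  · intro n hn
    rw [h0 n (by simpa using hn), norm_zero]
  · have := hasSum_single (f := fun n => PowerSeries.coeff n (PowerSeries.C c) * t ^ n) 0 h0
    simpa using this

lemma sumsTo_X (t : ℝ) : SumsTo t PowerSeries.X t := by
  have h0 : ∀ n, n ≠ 1 → PowerSeries.coeff n (PowerSeries.X : PowerSeries ℝ) * t ^ n = 0 := by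
    intro n hn
    simp [PowerSeries.coeff_X, hn]
  refine ⟨summable_of_ne_finset_zero (s := {1}) ?_, ?_⟩
  · intro n hn
    rw [h0 n (by simpa using hn), norm_zero]
  · have := hasSum_single
      (f := fun n => PowerSeries.coeff n (PowerSeries.X : PowerSeries ℝ) * t ^ n) 1 h0
    simpa using this

lemma sumsTo_one (t : ℝ) : SumsTo t 1 1 := by
  simpa using sumsTo_C t 1

lemma sumsTo_prod {ι : Type*} (s : Finset ι) (t : ℝ) (φ : ι → PowerSeries ℝ) (S : ι → ℝ)
    (h : ∀ i ∈ s, SumsTo t (φ i) (S i)) : SumsTo t (∏ i ∈ s, φ i) (∏ i ∈ s, S i) := by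
  classical
  induction s using Finset.induction_on with
  | empty => simpa using sumsTo_one t
  | insert a s ha ih =>
    rw [Finset.prod_insert ha, Finset.prod_insert ha]
    exact (h a (by simp)).mul (ih fun i hi => h i (by simp [hi]))

lemma sumsTo_geom {t : ℝ} (ht : |t| < 1) : SumsTo t (PowerSeries.mk fun _ => 1) (1 - t)⁻¹ := by
  constructor
  · simpa using summable_geometric_of_lt_one (abs_nonneg t) ht
  · simpa using hasSum_geometric_of_abs_lt_one ht

/-- Normalised squares. -/
noncomputable def aH (x : ℝ) (n : ℕ) : ℝ := hermiteH n x ^ 2 / (2 ^ n * (Nat.factorial n : ℝ))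

lemma aH_nonneg (x : ℝ) (n : ℕ) : 0 ≤ aH x n := by unfold aH; positivity

lemma hermiteH_rec (n : ℕ) (x : ℝ) :
    hermiteH (n + 2) x = 2 * x * hermiteH (n + 1) x - 2 * (n + 1) * hermiteH n x := by
  simp [hermiteH]

lemma aH_rec (x : ℝ) (n : ℕ) :
    (n + 3) * aH x (n + 3) = (2 * x ^ 2 - (n + 2)) * aH x (n + 2)
      + (n + 2 - 2 * x ^ 2) * aH x (n + 1) + (n + 1) * aH x n := by
  unfold aH
  have h3 := hermiteH_rec (n + 1) x
  have h2 := hermiteH_rec n x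
  simp only [Nat.factorial_succ, pow_succ]
  push_cast at *
  have hn : (Nat.factorial n : ℝ) ≠ 0 := by positivity
  have h1' : (n : ℝ) + 1 ≠ 0 := by positivity
  have h2' : (n : ℝ) + 1 + 1 ≠ 0 := by positivity
  have h2'' : (n : ℝ) + 2 ≠ 0 := by positivity
  have h3' : (n : ℝ) + 2 + 1 ≠ 0 := by positivity
  rw [show n + 3 = n + 1 + 2 from rfl, h3, show n + 1 + 1 = n + 2 from rfl, h2]
  field_simp
  ring

lemma aH_step (x : ℝ) (δ : ℝ) (hδ : 0 < δ) (n : ℕ) :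
    aH x (n + 2) ≤ (1 + δ⁻¹) * (2 * x ^ 2) / (n + 2) * aH x (n + 1) + (1 + δ) * aH x n := by
  have h2 := hermiteH_rec n x
  have key : hermiteH (n + 2) x ^ 2 ≤ (1 + δ⁻¹) * (2 * x * hermiteH (n + 1) x) ^ 2
      + (1 + δ) * (2 * (n + 1) * hermiteH n x) ^ 2 := by
    rw [h2]
    set A := 2 * x * hermiteH (n + 1) x
    set B := 2 * ((n : ℝ) + 1) * hermiteH n x
    have : (1 + δ⁻¹) * A ^ 2 + (1 + δ) * B ^ 2 - (A - B) ^ 2 = δ⁻¹ * (A + δ * B) ^ 2 := by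
      field_simp
      ring
    have : 0 ≤ δ⁻¹ * (A + δ * B) ^ 2 := by positivity
    linarith
  have hle : (n + 1 : ℝ) / (n + 2) ≤ 1 := by
    rw [div_le_one (by positivity)]; linarith
  have e : ((1 + δ⁻¹) * (2 * x * hermiteH (n + 1) x) ^ 2
      + (1 + δ) * (2 * (n + 1) * hermiteH n x) ^ 2) / (2 ^ (n + 2) * (Nat.factorial (n + 2) : ℝ))
      = (1 + δ⁻¹) * (2 * x ^ 2) / (n + 2) * aH x (n + 1) +
        (1 + δ) * aH x n * ((n + 1 : ℝ) / (n + 2)) := by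
    unfold aH
    simp only [Nat.factorial_succ, pow_succ]
    push_cast
    have hn : (Nat.factorial n : ℝ) ≠ 0 := by positivity
    have h1' : (n : ℝ) + 1 ≠ 0 := by positivity
    have h2' : (n : ℝ) + 1 + 1 ≠ 0 := by positivity
    have h2'' : (n : ℝ) + 2 ≠ 0 := by positivity
    field_simp
    ring
  have h3 : aH x (n + 2) ≤ (1 + δ⁻¹) * (2 * x ^ 2) / (n + 2) * aH x (n + 1) +
        (1 + δ) * aH x n * ((n + 1 : ℝ) / (n + 2)) := by
    rw [← e]
    unfold aH
    gcongr
  have h4 : (1 + δ) * aH x n * ((n + 1 : ℝ) / (n + 2)) ≤ (1 + δ) * aH x n := by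
    apply mul_le_of_le_one_right _ hle
    have := aH_nonneg x n
    positivity
  linarith

lemma aH_bound (x δ : ℝ) (hδ : 0 < δ) : ∃ K, 0 ≤ K ∧ ∀ n, aH x n ≤ K * (1 + δ) ^ n := by
  obtain ⟨N, hN⟩ := exists_nat_ge ((1 + δ⁻¹) * (2 * x ^ 2) / δ)
  have hK : 0 ≤ ∑ i ∈ Finset.range (N + 2), aH x i := Finset.sum_nonneg fun i _ => aH_nonneg x i
  refine ⟨∑ i ∈ Finset.range (N + 2), aH x i, hK, ?_⟩
  set K := ∑ i ∈ Finset.range (N + 2), aH x i with hKd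
  intro n
  induction n using Nat.strong_induction_on with
  | _ n ih =>
    by_cases hn : n < N + 2
    · have h1 : aH x n ≤ K :=
        Finset.single_le_sum (f := aH x) (fun i _ => aH_nonneg x i) (Finset.mem_range.2 hn)
      have h2 : 1 ≤ (1 + δ) ^ n := one_le_pow₀ (by linarith)
      exact h1.trans (le_mul_of_one_le_right hK h2)
    · obtain ⟨m, rfl⟩ : ∃ m, n = m + 2 := ⟨n - 2, by omega⟩
      have hm : (N : ℝ) ≤ m := by exact_mod_cast (by omega : N ≤ m)
      have hc : (1 + δ⁻¹) * (2 * x ^ 2) / (m + 2) ≤ δ := by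
        rw [div_le_iff₀ hδ] at hN
        rw [div_le_iff₀ (by positivity)]
        nlinarith
      have i1 := ih (m + 1) (by omega)
      have i0 := ih m (by omega)
      calc aH x (m + 2) ≤ _ := aH_step x δ hδ m
        _ ≤ δ * (K * (1 + δ) ^ (m + 1)) + (1 + δ) * (K * (1 + δ) ^ m) := by
          have := aH_nonneg x (m + 1)
          gcongr
        _ = K * (1 + δ) ^ (m + 2) := by ring

lemma aH_summable (x r : ℝ) (hr0 : 0 ≤ r) (hr : r < 1) :
    Summable (fun n : ℕ => ((n : ℝ) + 1) * aH x n * r ^ n) := by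
  obtain ⟨δ, hδ, hδr⟩ : ∃ δ : ℝ, 0 < δ ∧ (1 + δ) * r < 1 := by
    refine ⟨(1 - r) / 2, by linarith, ?_⟩
    nlinarith
  obtain ⟨K, hK, hb⟩ := aH_bound x δ hδ
  have hq : ‖(1 + δ) * r‖ < 1 := by
    rw [Real.norm_of_nonneg (by positivity)]; exact hδr
  have s1 := summable_pow_mul_geometric_of_norm_lt_one 1 hq
  have s0 := summable_pow_mul_geometric_of_norm_lt_one 0 hq
  refine Summable.of_nonneg_of_le (fun n => ?_) (fun n => ?_) ((s1.add s0).mul_left K)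
  · have := aH_nonneg x n
    positivity
  · calc ((n : ℝ) + 1) * aH x n * r ^ n ≤ ((n : ℝ) + 1) * (K * (1 + δ) ^ n) * r ^ n := by
          gcongr
          exact hb n
      _ = _ := by rw [mul_pow]; ring

/-- Generating series. -/
noncomputable def FS (x : ℝ) : PowerSeries ℝ := PowerSeries.mk (aH x)
/-- Derivative of the generating series. -/
noncomputable def DS (x : ℝ) : PowerSeries ℝ := PowerSeries.mk fun n => (n + 1) * aH x (n + 1)

lemma FS_summable (x t : ℝ) (ht : |t| < 1) :
    Summable (fun n => ‖PowerSeries.coeff n (FS x) * t ^ n‖) := by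
  refine Summable.of_nonneg_of_le (fun _ => norm_nonneg _) (fun n => ?_)
    (aH_summable x |t| (abs_nonneg t) ht)
  have := aH_nonneg x n
  rw [FS, PowerSeries.coeff_mk, norm_mul, norm_pow, Real.norm_of_nonneg this, Real.norm_eq_abs]
  gcongr
  nlinarith [(Nat.cast_nonneg n : (0:ℝ) ≤ n)]

lemma der_summable (x r : ℝ) (hr0 : 0 ≤ r) (hr : r < 1) :
    Summable (fun n : ℕ => (n : ℝ) * aH x n * r ^ (n - 1)) := by
  rcases hr0.eq_or_lt with h | h
  · subst h
    refine summable_of_ne_finset_zero (s := {1}) fun n hn => ?_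
    rcases n with _ | _ | n <;> simp at hn ⊢
  · refine Summable.of_nonneg_of_le (fun n => ?_) (fun n => ?_)
      ((aH_summable x r hr0 hr).mul_left r⁻¹)
    · have := aH_nonneg x n
      positivity
    · have := aH_nonneg x n
      rcases n with _ | n
      · simp; positivity
      · rw [Nat.add_sub_cancel, pow_succ]
        have e : r⁻¹ * ((((n + 1 : ℕ) : ℝ) + 1) * aH x (n + 1) * (r ^ n * r)) =
          (((n + 1 : ℕ) : ℝ) + 1) * aH x (n + 1) * r ^ n := by field_simp
        rw [e]
        gcongr
        linarith

lemma DS_summable (x t : ℝ) (ht : |t| < 1) :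
    Summable (fun n => ‖PowerSeries.coeff n (DS x) * t ^ n‖) := by
  have h := (summable_nat_add_iff 1).2 (der_summable x |t| (abs_nonneg t) ht)
  refine h.congr fun n => ?_
  have := aH_nonneg x (n + 1)
  rw [DS, PowerSeries.coeff_mk, norm_mul, norm_pow, Real.norm_of_nonneg (by positivity),
    Real.norm_eq_abs]
  simp

/-- Value of the generating function. -/
noncomputable def Fv (x t : ℝ) : ℝ := ∑' n, PowerSeries.coeff n (FS x) * t ^ n
/-- Value of the derivative. -/
noncomputable def Dv (x t : ℝ) : ℝ := ∑' n, PowerSeries.coeff n (DS x) * t ^ n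

lemma Fv_hasDerivAt (x t : ℝ) (ht : |t| < 1) : HasDerivAt (Fv x) (Dv x t) t := by
  obtain ⟨r, hr, hr1⟩ := exists_between ht
  have hr0 : 0 < r := (abs_nonneg t).trans_lt hr
  have hs := der_summable x r hr0.le hr1
  have hmem : ∀ y, y ∈ Set.Ioo (-r) r ↔ |y| < r := fun y => by rw [Set.mem_Ioo, abs_lt]
  have hbd : ∀ (n : ℕ) (y : ℝ), y ∈ Set.Ioo (-r) r →
      ‖aH x n * (n * y ^ (n - 1))‖ ≤ n * aH x n * r ^ (n - 1) := by
    intro n y hy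
    have hy' := ((hmem y).1 hy).le
    have := aH_nonneg x n
    rw [norm_mul, norm_mul, norm_pow, Real.norm_of_nonneg this, Real.norm_eq_abs, Real.norm_eq_abs,
      Nat.abs_cast]
    calc aH x n * (n * |y| ^ (n - 1)) ≤ aH x n * (n * r ^ (n - 1)) := by gcongr
      _ = _ := by ring
  have key := hasDerivAt_tsum_of_isPreconnected (g := fun (n : ℕ) y => aH x n * y ^ n)
    (g' := fun (n : ℕ) y => aH x n * (n * y ^ (n - 1))) (y₀ := t) (y := t) hs isOpen_Ioo
    isPreconnected_Ioo (fun n y _ => (hasDerivAt_pow n y).const_mul _) hbd ((hmem t).2 hr)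
    (by simpa [FS] using (FS_summable x t ht).of_norm) ((hmem t).2 hr)
  have e : Dv x t = ∑' n : ℕ, aH x n * (n * t ^ (n - 1)) := by
    have hsum : Summable (fun n : ℕ => aH x n * (n * t ^ (n - 1))) :=
      Summable.of_norm_bounded hs fun n => hbd n t ((hmem t).2 hr)
    rw [hsum.tsum_eq_zero_add]
    simp only [Dv, DS, PowerSeries.coeff_mk]
    simp
    refine tsum_congr fun n => by ring
  rw [e]
  have e2 : Fv x = fun z => ∑' n, aH x n * z ^ n := by
    funext z; simp [Fv, FS]
  rw [e2]
  exact key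

open PowerSeries in
lemma series_identity (x : ℝ) :
    DS x + X * DS x + C (-1) * (X * (X * DS x)) + C (-1) * (X * (X * (X * DS x))) =
      C (2 * x ^ 2) * FS x + C (1 - 2 * x ^ 2) * (X * FS x) + X * (X * FS x) := by
  ext n
  rcases n with _ | _ | _ | n
  · simp [DS, FS, aH, hermiteH]
    ring
  · simp only [map_add, coeff_C_mul, coeff_succ_X_mul, coeff_zero_X_mul, DS, FS, coeff_mk]
    simp [aH, hermiteH, Nat.factorial]
    ring
  · have := aH_rec x 0
    simp only [map_add, coeff_C_mul, coeff_succ_X_mul, coeff_zero_X_mul, DS, FS, coeff_mk]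
    norm_num at this ⊢
    linarith
  · have := aH_rec x (n + 1)
    simp only [map_add, coeff_C_mul, coeff_succ_X_mul, coeff_zero_X_mul, DS, FS, coeff_mk]
    push_cast at this ⊢
    have e1 : n + 1 + 1 = n + 2 := rfl
    have e2 : n + 1 + 2 = n + 3 := rfl
    have e3 : n + 1 + 3 = n + 4 := rfl
    simp only [e1, e2, e3, Nat.add_assoc, Nat.reduceAdd] at this ⊢
    linarith

lemma Fv_ode (x t : ℝ) (ht : |t| < 1) :
    (1 + t - t ^ 2 - t ^ 3) * Dv x t = (2 * x ^ 2 + (1 - 2 * x ^ 2) * t + t ^ 2) * Fv x t := by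
  have hF : SumsTo t (FS x) (Fv x t) := SumsTo.mk' (FS_summable x t ht)
  have hD : SumsTo t (DS x) (Dv x t) := SumsTo.mk' (DS_summable x t ht)
  have hX := sumsTo_X t
  have h1 := ((hD.add (hX.mul hD)).add ((sumsTo_C t (-1)).mul (hX.mul (hX.mul hD)))).add
    ((sumsTo_C t (-1)).mul (hX.mul (hX.mul (hX.mul hD))))
  have h2 := (((sumsTo_C t (2 * x ^ 2)).mul hF).add
    ((sumsTo_C t (1 - 2 * x ^ 2)).mul (hX.mul hF))).add (hX.mul (hX.mul hF))
  rw [series_identity] at h1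
  have := h1.unique h2
  linarith

lemma Fv_zero (x : ℝ) : Fv x 0 = 1 := by
  unfold Fv
  rw [tsum_eq_single 0]
  · simp [FS, aH, hermiteH]
  · intro n hn
    simp [hn]

lemma Fv_eq (x t : ℝ) (ht : |t| < 1) :
    Fv x t = (1 - t ^ 2) ^ (-(1 / 2) : ℝ) * Real.exp (2 * x ^ 2 * t / (1 + t)) := by
  have hder : ∀ s ∈ Set.Ioo (-1 : ℝ) 1, HasDerivAt
      (fun s => Fv x s * ((1 - s ^ 2) ^ (1 / 2 : ℝ) * Real.exp (-(2 * x ^ 2 * s / (1 + s))))) 0 s := by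
    intro s hs
    have hs' : |s| < 1 := abs_lt.2 hs
    have p1 : 0 < 1 + s := by linarith [hs.1]
    have p2 : 0 < 1 - s := by linarith [hs.2]
    have p3 : 0 < 1 - s ^ 2 := by nlinarith
    have d1 : HasDerivAt (fun s : ℝ => 1 - s ^ 2) (-(2 * s)) s := by
      simpa using (hasDerivAt_pow 2 s).const_sub 1
    have d2 := d1.rpow_const (p := (1 / 2 : ℝ)) (Or.inl p3.ne')
    have d3 : HasDerivAt (fun s : ℝ => -(2 * x ^ 2 * s / (1 + s)))
        (-((2 * x ^ 2 * (1 + s) - 2 * x ^ 2 * s * 1) / (1 + s) ^ 2)) s := by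
      have a : HasDerivAt (fun s : ℝ => 2 * x ^ 2 * s) (2 * x ^ 2) s := by
        simpa using (hasDerivAt_id s).const_mul (2 * x ^ 2)
      have b : HasDerivAt (fun s : ℝ => 1 + s) 1 s := by
        simpa using (hasDerivAt_id s).const_add 1
      exact (a.div b p1.ne').neg
    have d4 := (Fv_hasDerivAt x s hs').mul (d2.mul d3.exp)
    refine d4.congr_deriv ?_
    have ode := Fv_ode x s hs'
    have hD : Dv x s = (2 * x ^ 2 + (1 - 2 * x ^ 2) * s + s ^ 2) * Fv x s /
        ((1 - s ^ 2) * (1 + s)) := by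
      rw [eq_div_iff (by positivity), ← ode]; ring
    have hr : (1 - s ^ 2) ^ ((1 / 2 : ℝ) - 1) = (1 - s ^ 2) ^ (1 / 2 : ℝ) / (1 - s ^ 2) := by
      rw [Real.rpow_sub_one p3.ne']
    rw [hr, hD]
    have p3' := p3.ne'
    have p1' := p1.ne'
    simp only [Pi.mul_apply]
    field_simp
    ring
  have hc := isOpen_Ioo.is_const_of_deriv_eq_zero isPreconnected_Ioo
    (fun s hs => (hder s hs).differentiableAt.differentiableWithinAt)
    (fun s hs => (hder s hs).deriv) (abs_lt.1 ht : t ∈ Set.Ioo (-1 : ℝ) 1)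
    (by norm_num : (0 : ℝ) ∈ Set.Ioo (-1 : ℝ) 1)
  simp only [Fv_zero] at hc
  have p3 : 0 < 1 - t ^ 2 := by nlinarith [(abs_lt.1 ht).1, (abs_lt.1 ht).2]
  rw [Real.rpow_neg p3.le]
  rw [Real.exp_neg] at hc
  have q := (Real.rpow_pos_of_pos p3 (1 / 2)).ne'
  have q' := (Real.exp_pos (2 * x ^ 2 * t / (1 + t))).ne'
  field_simp at hc ⊢
  simpa using hc

lemma psi_sq (x : ℝ) (n : ℕ) :
    ψho n x ^ 2 = π ^ (-(1 / 2) : ℝ) * Real.exp (-x ^ 2) * aH x n := by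
  have hp := Real.pi_pos
  unfold ψho aH
  rw [mul_pow, mul_pow, inv_pow, Real.sq_sqrt (by positivity), ← Real.exp_nat_mul,
    Real.rpow_neg hp.le, ← Real.sqrt_eq_rpow]
  have : ((2 : ℕ) : ℝ) * (-x ^ 2 / 2) = -x ^ 2 := by push_cast; ring
  rw [this]
  field_simp

lemma psi_sumsTo (x t : ℝ) (ht : |t| < 1) :
    SumsTo t (PowerSeries.mk fun n => ψho n x ^ 2)
      (π ^ (-(1 / 2) : ℝ) * (1 - t ^ 2) ^ (-(1 / 2) : ℝ) *
        Real.exp (-x ^ 2 * (1 - t) / (1 + t))) := by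
  have hF : SumsTo t (FS x) (Fv x t) := SumsTo.mk' (FS_summable x t ht)
  have h := (sumsTo_C t (π ^ (-(1 / 2) : ℝ) * Real.exp (-x ^ 2))).mul hF
  have p1 : 1 + t ≠ 0 := by linarith [(abs_lt.1 ht).1]
  convert h using 1
  · ext n
    rw [PowerSeries.coeff_C_mul, FS, PowerSeries.coeff_mk, PowerSeries.coeff_mk, psi_sq]
  · have : -x ^ 2 * (1 - t) / (1 + t) = -x ^ 2 + 2 * x ^ 2 * t / (1 + t) := by
      field_simp
      ring
    rw [Fv_eq x t ht, this, Real.exp_add]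
    ring

lemma fermiDensity_eq (d M : ℕ) (x : EuclideanSpace ℝ (Fin d)) :
    fermiDensity d M x = PowerSeries.coeff M
      ((∏ j, PowerSeries.mk fun n => ψho n (x j) ^ 2) * PowerSeries.mk fun _ => (1 : ℝ)) := by
  classical
  rw [PowerSeries.coeff_mul, Finset.Nat.sum_antidiagonal_eq_sum_range_succ_mk]
  simp only [PowerSeries.coeff_mk, mul_one, PowerSeries.coeff_prod]
  unfold fermiDensity
  rw [← Finset.sum_fiberwise_of_maps_to (s := Finset.filter (fun l => ∑ j, l j ≤ M)
      (Fintype.piFinset fun _ : Fin d => Finset.range (M + 1))) (t := Finset.range (M + 1))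
      (g := fun l => ∑ j, l j)]
  · refine Finset.sum_congr rfl fun k hk => ?_
    have hk' : k ≤ M := by simpa [Nat.lt_succ_iff] using hk
    refine Finset.sum_bij' (fun l _ => Finsupp.equivFunOnFinite.symm l) (fun l _ => ⇑l) ?_ ?_ ?_ ?_ ?_
    · intro l hl
      simp only [Finset.mem_filter] at hl
      simp [Finset.mem_finsuppAntidiag, hl.2]
    · intro l hl
      have hs : ∑ j, l j = k := by simpa [Finset.mem_finsuppAntidiag] using hl
      simp only [Finset.mem_filter, Fintype.mem_piFinset, Finset.mem_range]
      refine ⟨⟨fun j => ?_, by omega⟩, hs⟩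
      have := Finset.single_le_sum (f := fun j => l j) (fun i _ => Nat.zero_le _) (Finset.mem_univ j)
      omega
    · intro l _; rfl
    · intro l _; ext; rfl
    · intro l _; rfl
  · intro l hl
    simp only [Finset.mem_filter] at hl
    simp only [Finset.mem_range]
    omega

/-- for `d ≥ 1`, `x ∈ ℝ^d`, `|t| < 1`, the generating function
`G(x;t) = Σ_M ρ^{M,d}(x) t^M` converges and satisfies
`(1-t) G(x;t) = π^{-d/2} (1-t²)^{-d/2} exp(-‖x‖² (1-t)/(1+t))`. -/
theorem fermi_density_generating_function (d : ℕ) (hd : 1 ≤ d)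
    (x : EuclideanSpace ℝ (Fin d)) (t : ℝ) (ht : |t| < 1) :
    ∃ G : ℝ, HasSum (fun M : ℕ => fermiDensity d M x * t ^ M) G ∧
      (1 - t) * G =
        π ^ (-(d : ℝ) / 2) * (1 - t ^ 2) ^ (-(d : ℝ) / 2) *
          Real.exp (-‖x‖ ^ 2 * (1 - t) / (1 + t)) := by
  have h := (sumsTo_prod Finset.univ t (fun j => PowerSeries.mk fun n => ψho n (x j) ^ 2) _
    (fun j _ => psi_sumsTo (x j) t ht)).mul (sumsTo_geom ht)
  refine ⟨_, (?_ : HasSum _ ((∏ i, π ^ (-(1 / 2) : ℝ) * (1 - t ^ 2) ^ (-(1 / 2) : ℝ) *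
    Real.exp (-x i ^ 2 * (1 - t) / (1 + t))) * (1 - t)⁻¹)), ?_⟩
  · simp_rw [fermiDensity_eq]
    exact h.2
  have p1 : 1 - t ≠ 0 := by linarith [(abs_lt.1 ht).2]
  have p3 : 0 < 1 - t ^ 2 := by nlinarith [(abs_lt.1 ht).1, (abs_lt.1 ht).2]
  rw [mul_comm (1 - t), mul_assoc, inv_mul_cancel₀ p1, mul_one, Finset.prod_mul_distrib,
    Finset.prod_const, mul_pow, ← Real.exp_sum, Finset.card_univ, Fintype.card_fin,
    ← Real.rpow_natCast, ← Real.rpow_natCast, ← Real.rpow_mul Real.pi_pos.le,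
    ← Real.rpow_mul p3.le, EuclideanSpace.norm_sq_eq, ← Finset.sum_div, ← Finset.sum_mul,
    Finset.sum_neg_distrib]
  have e : -(1 / 2 : ℝ) * d = -(d : ℝ) / 2 := by ring
  rw [e]
  simp only [Real.norm_eq_abs, sq_abs]
end

section
/- For every integer d ≥ 1, every integer M ≥ 0 and every k ∈ ℝ^d, the d-dimensional Fourier transform of the ground-state density satisfies ∫_{ℝ^d} ρ^{M,d}(x) e^{i ⟨k, x⟩} dx = e^{-‖k‖²/4} L_M^{(d)}(‖k‖²/2). -/
open MeasureTheory Real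

lemma choose_conv (m : ℕ) : ∀ n i : ℕ,
    ∑ a ∈ Finset.range (n + 1), a.choose i * (n - a).choose m = (n + 1).choose (i + m + 1) := by
  induction m with
  | zero =>
    intro n i
    simp only [Nat.choose_zero_right, mul_one, add_zero]
    induction n with
    | zero => simp [Nat.choose_succ_succ]
    | succ n ih => rw [Finset.sum_range_succ, ih, Nat.choose_succ_succ (n + 1), add_comm]
  | succ m ihm =>
    intro n
    induction n with
    | zero => intro i; rw [Nat.choose_eq_zero_of_lt (by omega)]; simp
    | succ n ihn =>
      intro i
      rw [Finset.sum_range_succ]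
      have : ∀ a ∈ Finset.range (n + 1), a.choose i * (n + 1 - a).choose (m + 1)
          = a.choose i * (n - a).choose m + a.choose i * (n - a).choose (m + 1) := by
        intro a ha
        have ha' : a ≤ n := by simpa [Nat.lt_succ_iff] using ha
        rw [Nat.succ_sub ha', Nat.succ_eq_add_one, Nat.choose_succ_succ, mul_add]
      rw [Finset.sum_congr rfl this, Finset.sum_add_distrib, ihm, ihn]
      simp
      rw [show i + (m + 1) + 1 = (i + m + 1) + 1 by ring, Nat.choose_succ_succ (n + 1)]

lemma choose_conv' (n i j β : ℕ) :
    ∑ a ∈ Finset.range (n + 1), a.choose i * (n - a + β).choose (j + β)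
      = (n + β + 1).choose (i + j + β + 1) := by
  have h := choose_conv (j + β) (n + β) i
  rw [show i + j + β + 1 = i + (j + β) + 1 by ring, ← h,
    show n + β + 1 = (n + 1) + β by ring,
    Finset.sum_range_add _ (n + 1) β]
  rw [Finset.sum_eq_zero (s := Finset.range β), add_zero]
  · refine Finset.sum_congr rfl fun a ha => ?_
    have ha' : a ≤ n := by simpa [Nat.lt_succ_iff] using ha
    rw [show n + β - a = n - a + β by omega]
  · intro b hb
    have hb' : b < β := by simpa using hb
    rw [Nat.choose_eq_zero_of_lt (n := n + β - (n + 1 + b)), mul_zero]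
    omega

lemma laguerre_eq (n α N : ℕ) (h : n ≤ N) (x : ℝ) :
    laguerreL n α x = ∑ k ∈ Finset.range (N + 1),
      (-x) ^ k / (k.factorial : ℝ) * ((n + α).choose (k + α) : ℝ) := by
  unfold laguerreL
  rw [← Finset.sum_subset (Finset.range_mono (show n + 1 ≤ N + 1 by omega))]
  · refine Finset.sum_congr rfl fun k hk => ?_
    have hk' : k ≤ n := by simpa [Nat.lt_succ_iff] using hk
    rw [← Nat.choose_symm (show k + α ≤ n + α by omega), show n + α - (k + α) = n - k by omega,
      neg_pow x]
    ring
  · intro k _ hk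
    have hk' : n < k := by simpa using hk
    rw [Nat.choose_eq_zero_of_lt (by omega)]
    simp

lemma laguerre_add (n β : ℕ) (x y : ℝ) :
    ∑ a ∈ Finset.range (n + 1), laguerreL a 0 x * laguerreL (n - a) β y
      = laguerreL n (β + 1) (x + y) := by
  have h1 : ∀ a ∈ Finset.range (n + 1), laguerreL a 0 x * laguerreL (n - a) β y
      = ∑ i ∈ Finset.range (n + 1), ∑ j ∈ Finset.range (n + 1),
        (-x) ^ i / (i.factorial : ℝ) * ((-y) ^ j / (j.factorial : ℝ)) *
          ((a.choose i * (n - a + β).choose (j + β) : ℕ) : ℝ) := by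
    intro a ha
    have ha' : a ≤ n := by simpa [Nat.lt_succ_iff] using ha
    rw [laguerre_eq a 0 n ha', laguerre_eq (n - a) β n (by omega), Finset.sum_mul_sum]
    refine Finset.sum_congr rfl fun i _ => Finset.sum_congr rfl fun j _ => ?_
    push_cast
    simp only [add_zero]
    ring
  rw [Finset.sum_congr rfl h1, Finset.sum_comm]
  have h2 : ∀ i ∈ Finset.range (n + 1), ∑ a ∈ Finset.range (n + 1), ∑ j ∈ Finset.range (n + 1),
        (-x) ^ i / (i.factorial : ℝ) * ((-y) ^ j / (j.factorial : ℝ)) *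
          ((a.choose i * (n - a + β).choose (j + β) : ℕ) : ℝ)
      = ∑ j ∈ Finset.range (n + 1), (-x) ^ i / (i.factorial : ℝ) * ((-y) ^ j / (j.factorial : ℝ)) *
          ((n + β + 1).choose (i + j + β + 1) : ℝ) := by
    intro i _
    rw [Finset.sum_comm]
    refine Finset.sum_congr rfl fun j _ => ?_
    rw [← Finset.mul_sum, ← Nat.cast_sum, choose_conv']
  rw [Finset.sum_congr rfl h2, laguerre_eq n (β + 1) n le_rfl]
  have h3 : ∀ k ∈ Finset.range (n + 1), (-(x + y)) ^ k / (k.factorial : ℝ) *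
        ((n + (β + 1)).choose (k + (β + 1)) : ℝ)
      = ∑ p ∈ Finset.HasAntidiagonal.antidiagonal k, (-x) ^ p.1 / (p.1.factorial : ℝ) *
          ((-y) ^ p.2 / (p.2.factorial : ℝ)) * ((n + β + 1).choose (p.1 + p.2 + β + 1) : ℝ) := by
    intro k _
    rw [neg_add, (Commute.all (-x) (-y)).add_pow', Finset.sum_div, Finset.sum_mul]
    refine Finset.sum_congr rfl fun p hp => ?_
    have hp' : p.1 + p.2 = k := by simpa using hp
    subst hp'
    have := Nat.choose_mul_factorial_mul_factorial (Nat.le_add_right p.1 p.2)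
    rw [Nat.add_sub_cancel_left] at this
    have h' : ((p.1 + p.2).choose p.1 : ℝ) * p.1.factorial * p.2.factorial
      = (p.1 + p.2).factorial := by exact_mod_cast this
    rw [← h', nsmul_eq_mul]
    have a1 : (p.1.factorial : ℝ) ≠ 0 := by positivity
    have a2 : (p.2.factorial : ℝ) ≠ 0 := by positivity
    have a3 : ((p.1 + p.2).choose p.1 : ℝ) ≠ 0 := by
      have := Nat.choose_pos (Nat.le_add_right p.1 p.2)
      positivity
    rw [show n + (β + 1) = n + β + 1 by ring, show p.1 + p.2 + (β + 1) = p.1 + p.2 + β + 1 by ring]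
    field_simp
  rw [Finset.sum_congr rfl h3]
  rw [← Finset.sum_product', Finset.sum_sigma']
  symm
  refine Finset.sum_of_injOn (fun q => q.2) ?_ ?_ ?_ ?_
  · rintro ⟨k, p⟩ hq ⟨k', p'⟩ hq' h
    simp at hq hq' h
    subst h
    have : k = k' := by omega
    subst this; rfl
  · rintro ⟨k, p⟩ hq
    simp at hq ⊢
    omega
  · rintro ⟨i, j⟩ hq hq'
    simp at hq hq'
    rw [Nat.choose_eq_zero_of_lt, Nat.cast_zero, mul_zero]
    simp only
    omega
  · rintro ⟨k, p⟩ hq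
    rfl

def occ (d M : ℕ) : Finset (Fin d → ℕ) :=
  Finset.filter (fun l => ∑ j, l j ≤ M)
      (Fintype.piFinset fun _ : Fin d => Finset.range (M + 1))

lemma mem_occ (d M : ℕ) (l : Fin d → ℕ) : l ∈ occ d M ↔ ∑ j, l j ≤ M := by
  simp only [occ, Finset.mem_filter, Fintype.mem_piFinset, Finset.mem_range, and_iff_right_iff_imp]
  intro h j
  have := Finset.single_le_sum (f := l) (fun _ _ => Nat.zero_le _) (Finset.mem_univ j)
  omega

lemma laguerre_zero (M : ℕ) : laguerreL M 0 0 = 1 := by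
  rw [laguerre_eq M 0 M le_rfl, Finset.sum_range_succ']
  simp

lemma occ_sum (d : ℕ) : ∀ (M : ℕ) (t : Fin d → ℝ),
    ∑ l ∈ occ d M, ∏ j, laguerreL (l j) 0 (t j) = laguerreL M d (∑ j, t j) := by
  induction d with
  | zero =>
    intro M t
    have : occ 0 M = {Fin.elim0} := by
      ext l
      simp [mem_occ, Subsingleton.elim l Fin.elim0]
    simp [this, laguerre_zero]
  | succ d ih =>
    intro M t
    rw [Fin.sum_univ_succ, ← laguerre_add]
    simp_rw [← ih, Finset.mul_sum]
    rw [Finset.sum_sigma']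
    refine Finset.sum_bij' (fun l _ => ⟨l 0, fun j => l j.succ⟩)
      (fun q _ => Fin.cons q.1 q.2) ?_ ?_ ?_ ?_ ?_
    · intro l hl
      rw [mem_occ, Fin.sum_univ_succ] at hl
      simp only [Finset.mem_sigma, Finset.mem_range, mem_occ]
      omega
    · rintro ⟨a, l⟩ hl
      simp only [Finset.mem_sigma, Finset.mem_range, mem_occ] at hl
      rw [mem_occ, Fin.sum_univ_succ]
      simp
      omega
    · intro l _
      exact Fin.cons_self_tail l
    · rintro ⟨a, l⟩ _
      simp
    · intro l _
      rw [Fin.prod_univ_succ]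

/-! one-dimensional part -/

lemma herm_deriv (n : ℕ) : ∀ x : ℝ, HasDerivAt (hermiteH n) (2 * n * hermiteH (n - 1) x) x ∧
    hermiteH (n + 1) x = 2 * x * hermiteH n x - 2 * n * hermiteH (n - 1) x := by
  have main : ∀ n : ℕ, ∀ x : ℝ, HasDerivAt (hermiteH n) (2 * n * hermiteH (n - 1) x) x := by
    intro n
    induction n using Nat.strong_induction_on with
    | _ n ih =>
      intro x
      match n, ih with
      | 0, _ => simpa [hermiteH] using hasDerivAt_const x (1 : ℝ)
      | 1, _ => simpa [hermiteH] using (hasDerivAt_id x).const_mul (2 : ℝ)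
      | 2, ih =>
        have h1 := ih 1 (by norm_num) x
        have h0 := ih 0 (by norm_num) x
        have := (((hasDerivAt_id x).const_mul (2 : ℝ)).mul h1).sub (h0.const_mul (2 * ((0 : ℕ) + 1 : ℝ)))
        refine HasDerivAt.congr_deriv this ?_
        simp [hermiteH]
        ring
      | n + 3, ih =>
        have h1 := ih (n + 2) (by omega) x
        have h0 := ih (n + 1) (by omega) x
        have := (((hasDerivAt_id x).const_mul (2 : ℝ)).mul h1).sub
          (h0.const_mul (2 * ((n + 1 : ℕ) + 1 : ℝ)))
        refine HasDerivAt.congr_deriv this ?_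
        simp [hermiteH]
        ring
  intro x
  refine ⟨main n x, ?_⟩
  match n with
  | 0 => simp [hermiteH]
  | n + 1 => simp [hermiteH]

lemma herm_poly (n : ℕ) : ∃ p : Polynomial ℝ, ∀ x, hermiteH n x = p.eval x := by
  induction n using Nat.strong_induction_on with
  | _ n ih =>
    match n, ih with
    | 0, _ => exact ⟨1, by simp [hermiteH]⟩
    | 1, _ => exact ⟨2 * Polynomial.X, by simp [hermiteH]⟩
    | n + 2, ih =>
      obtain ⟨p, hp⟩ := ih (n + 1) (by omega)
      obtain ⟨q, hq⟩ := ih n (by omega)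
      exact ⟨2 * Polynomial.X * p - Polynomial.C (2 * (n + 1 : ℝ)) * q, by
        intro x; simp [hermiteH, hp, hq]⟩

/-- the weight -/
noncomputable def wt (k x : ℝ) : ℂ := Complex.exp (-(x : ℂ) ^ 2 + Complex.I * (k * x))

lemma wt_norm (k x : ℝ) : ‖wt k x‖ = Real.exp (-x ^ 2) := by
  rw [wt, Complex.norm_exp]
  congr 1
  simp [pow_two]

lemma wt_cont (k : ℝ) : Continuous (wt k) := by
  unfold wt; fun_prop

lemma wt_deriv (k x : ℝ) : HasDerivAt (wt k) ((-2 * x + Complex.I * k) * wt k x) x := by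
  have h : HasDerivAt (fun z : ℂ => Complex.exp (-z ^ 2 + Complex.I * (k * z)))
      (Complex.exp (-(x : ℂ) ^ 2 + Complex.I * (k * x)) *
        (-(2 * (x : ℂ)) + Complex.I * (k * 1))) (x : ℂ) := by
    refine HasDerivAt.cexp (HasDerivAt.add ?_ ?_)
    · have := (hasDerivAt_pow 2 (x : ℂ)).fun_neg
      simpa using this
    · exact ((hasDerivAt_id _).const_mul _).const_mul _
  have := h.comp_ofReal
  refine HasDerivAt.congr_deriv this ?_
  unfold wt; ring

lemma integrable_poly (p : Polynomial ℝ) (k : ℝ) :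
    Integrable (fun x : ℝ => ((p.eval x : ℝ) : ℂ) * wt k x) := by
  induction p using Polynomial.induction_on' with
  | add p q hp hq =>
    refine (hp.add hq).congr (Filter.Eventually.of_forall fun x => ?_)
    simp [add_mul]
  | monomial n a =>
    have h := integrable_rpow_mul_exp_neg_mul_sq (b := 1) one_pos (s := n)
      (by have : (0 : ℝ) ≤ n := by positivity
          linarith)
    have h2 := h.norm.const_mul |a|
    refine h2.mono' ?_ ?_
    · refine Continuous.aestronglyMeasurable ?_
      have := wt_cont k
      fun_prop
    · refine Filter.Eventually.of_forall fun x => ?_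
      simp [wt_norm, Real.rpow_natCast, abs_mul, mul_assoc]

lemma integrable_hh (m n : ℕ) (k : ℝ) :
    Integrable (fun x : ℝ => ((hermiteH m x * hermiteH n x : ℝ) : ℂ) * wt k x) := by
  obtain ⟨p, hp⟩ := herm_poly m
  obtain ⟨q, hq⟩ := herm_poly n
  convert integrable_poly (p * q) k using 4 with x
  simp [hp, hq]

noncomputable def II (k : ℝ) (m n : ℕ) : ℂ :=
  ∫ x : ℝ, ((hermiteH m x * hermiteH n x : ℝ) : ℂ) * wt k x

lemma II_symm (k : ℝ) (m n : ℕ) : II k m n = II k n m := by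
  simp only [II, mul_comm (hermiteH m _)]

lemma II_succ (k : ℝ) (m n : ℕ) :
    II k m (n + 1) = 2 * m * II k (m - 1) n + Complex.I * k * II k m n := by
  have i1 := (integrable_hh (m - 1) n k).const_mul (2 * m : ℂ)
  have i2 := (integrable_hh m n k).const_mul (Complex.I * k)
  have i3 := integrable_hh m (n + 1) k
  have hd : ∀ x : ℝ, HasDerivAt (fun x : ℝ => ((hermiteH m x * hermiteH n x : ℝ) : ℂ) * wt k x)
      ((2 * m : ℂ) * (((hermiteH (m - 1) x * hermiteH n x : ℝ) : ℂ) * wt k x)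
        + (Complex.I * k) * (((hermiteH m x * hermiteH n x : ℝ) : ℂ) * wt k x)
        - ((hermiteH m x * hermiteH (n + 1) x : ℝ) : ℂ) * wt k x) x := by
    intro x
    have h1 := (herm_deriv m x).1
    have h2 := (herm_deriv n x).1
    have := ((h1.mul h2).ofReal_comp).mul (wt_deriv k x)
    refine HasDerivAt.congr_deriv this ?_
    rw [(herm_deriv n x).2]
    push_cast [Pi.mul_apply]
    ring
  have h0 := integral_eq_zero_of_hasDerivAt_of_integrable hd ((i1.add i2).sub i3)
    (integrable_hh m n k)
  rw [integral_sub (f := fun x : ℝ => (2 * m : ℂ) * (((hermiteH (m - 1) x * hermiteH n x : ℝ) : ℂ) * wt k x)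
        + (Complex.I * k) * (((hermiteH m x * hermiteH n x : ℝ) : ℂ) * wt k x)) (i1.add i2) i3,
    integral_add i1 i2, integral_const_mul, integral_const_mul] at h0
  unfold II
  linear_combination -h0

lemma II_zero (k : ℝ) : II k 0 0 = (Real.sqrt π : ℂ) * Complex.exp (-(k : ℂ) ^ 2 / 4) := by
  have := fourierIntegral_gaussian (b := 1) (by simp) (k : ℂ)
  unfold II wt
  simp only [hermiteH]
  rw [show (Real.sqrt π : ℂ) = ((π : ℂ) / 1) ^ (1 / 2 : ℂ) by
    rw [div_one, Real.sqrt_eq_rpow, Complex.ofReal_cpow Real.pi_pos.le]; simp]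
  rw [show (-(k : ℂ) ^ 2 / 4) = -(k : ℂ) ^ 2 / (4 * 1) by ring, ← this]
  congr 1
  ext x
  rw [← Complex.exp_add]
  simp
  congr 1
  ring

/-- the closed form -/
noncomputable def JJ (z : ℂ) (m n : ℕ) : ℂ :=
  ∑ j ∈ Finset.range (n + 1), (m.choose j : ℂ) * n.choose j * j.factorial * 2 ^ j *
    (z ^ (m - j) * z ^ (n - j))

lemma JJ_succ (z : ℂ) (m n : ℕ) :
    JJ z m (n + 1) = 2 * m * JJ z (m - 1) n + z * JJ z m n := by
  unfold JJ
  rw [Finset.sum_range_succ']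
  have e1 : ∀ j ∈ Finset.range (n + 1), (m.choose (j + 1) : ℂ) * (n + 1).choose (j + 1) *
      (j + 1).factorial * 2 ^ (j + 1) * (z ^ (m - (j + 1)) * z ^ (n + 1 - (j + 1)))
      = 2 * m * (((m - 1).choose j : ℂ) * n.choose j * j.factorial * 2 ^ j *
          (z ^ (m - 1 - j) * z ^ (n - j))) +
        z * ((m.choose (j + 1) : ℂ) * n.choose (j + 1) *
      (j + 1).factorial * 2 ^ (j + 1) * (z ^ (m - (j + 1)) * z ^ (n - (j + 1)))) := by
    intro j hj
    have hj' : j ≤ n := by simpa [Nat.lt_succ_iff] using hj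
    have c1 : (m.choose (j + 1) : ℂ) * (j + 1) = m * (m - 1).choose j := by
      cases m with
      | zero => simp
      | succ m =>
        have := Nat.add_one_mul_choose_eq m j
        simp only [Nat.add_sub_cancel]
        exact_mod_cast this.symm
    rw [Nat.choose_succ_succ n j, Nat.factorial_succ, show m - (j + 1) = m - 1 - j by omega,
      show n + 1 - (j + 1) = n - j by omega]
    rcases hj'.lt_or_eq with h | h
    · rw [show n - j = n - (j + 1) + 1 by omega]
      push_cast
      rw [pow_succ]
      linear_combination (2 ^ (j + 1) * (n.choose j : ℂ) * j.factorial * z ^ (m - 1 - j) *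
        z ^ (n - (j + 1)) * z) * c1
    · subst h
      simp
      linear_combination (2 ^ (j + 1) * (j.factorial : ℂ) * z ^ (m - 1 - j)) * c1
  rw [Finset.sum_congr rfl e1, Finset.sum_add_distrib, ← Finset.mul_sum, ← Finset.mul_sum,
    add_assoc]
  congr 1
  rw [Finset.sum_range_succ, Finset.sum_range_succ' _ n, mul_add, mul_add]
  simp
  ring

lemma II_eq (k : ℝ) (n : ℕ) : ∀ m, II k m n = II k 0 0 * JJ (Complex.I * k) m n := by
  induction n with
  | zero =>
    intro m
    rw [II_symm]
    rw [show JJ (Complex.I * k) m 0 = (Complex.I * k) ^ m by simp [JJ]]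
    induction m with
    | zero => simp
    | succ m ih => rw [II_succ, ih, pow_succ]; simp; ring
  | succ n ih =>
    intro m
    rw [II_succ, JJ_succ, ih, ih]
    ring

lemma JJ_diag (k : ℝ) (n : ℕ) :
    JJ (Complex.I * k) n n = 2 ^ n * n.factorial * (laguerreL n 0 (k ^ 2 / 2) : ℂ) := by
  rw [laguerre_eq n 0 n le_rfl, JJ]
  push_cast
  rw [Finset.mul_sum, ← Finset.sum_range_reflect]
  refine Finset.sum_congr rfl fun j hj => ?_
  have hj' : j ≤ n := by simpa [Nat.lt_succ_iff] using hj
  obtain ⟨i, rfl⟩ := Nat.exists_eq_add_of_le hj'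
  have := Nat.choose_mul_factorial_mul_factorial (Nat.le_add_right j i)
  rw [Nat.add_sub_cancel_left] at this
  have h' : ((j + i).choose j : ℂ) * j.factorial * i.factorial
      = (j + i).factorial := by exact_mod_cast this
  have a1 : (j.factorial : ℂ) ≠ 0 := by exact_mod_cast j.factorial_ne_zero
  rw [show j + i + 1 - 1 - j = i by omega, show j + i - i = j by omega, ← h',
    Nat.choose_symm_add.symm]
  have hI : (Complex.I * k) ^ j * (Complex.I * k) ^ j = 2 ^ j * (-((k : ℂ) ^ 2 / 2)) ^ j := by
    rw [← mul_pow, ← mul_pow]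
    congr 1
    linear_combination (k : ℂ) ^ 2 * Complex.I_mul_I
  rw [hI, pow_add]
  simp only [add_zero]
  field_simp

lemma psi_sq_s1 (l : ℕ) (k x : ℝ) :
    (((ψho l x) ^ 2 : ℝ) : ℂ) * Complex.exp (Complex.I * (k * x))
      = ((2 ^ l * l.factorial * Real.sqrt π : ℝ) : ℂ)⁻¹ *
        (((hermiteH l x * hermiteH l x : ℝ) : ℂ) * wt k x) := by
  have h : (ψho l x) ^ 2 = (2 ^ l * l.factorial * Real.sqrt π)⁻¹ *
      (hermiteH l x * hermiteH l x) * Real.exp (-x ^ 2) := by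
    unfold ψho
    rw [mul_pow, mul_pow, inv_pow, Real.sq_sqrt (by positivity), ← Real.exp_nat_mul]
    rw [show ((2 : ℕ) : ℝ) * (-x ^ 2 / 2) = -x ^ 2 by push_cast; ring]
    ring
  rw [h, wt, Complex.exp_add]
  push_cast
  ring

lemma psi_int (l : ℕ) (k : ℝ) :
    Integrable (fun x : ℝ => (((ψho l x) ^ 2 : ℝ) : ℂ) * Complex.exp (Complex.I * (k * x))) := by
  simp_rw [psi_sq_s1]
  exact (integrable_hh l l k).const_mul _

lemma psi_fourier (l : ℕ) (k : ℝ) :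
    ∫ x : ℝ, (((ψho l x) ^ 2 : ℝ) : ℂ) * Complex.exp (Complex.I * (k * x))
      = ((Real.exp (-k ^ 2 / 4) * laguerreL l 0 (k ^ 2 / 2) : ℝ) : ℂ) := by
  simp_rw [psi_sq_s1]
  rw [integral_const_mul]
  have := II_eq k l l
  unfold II at this
  rw [this]
  have h0 := II_zero k
  unfold II at h0
  rw [h0, JJ_diag]
  have a1 : (l.factorial : ℂ) ≠ 0 := by exact_mod_cast l.factorial_ne_zero
  have a2 : (Real.sqrt π : ℂ) ≠ 0 := by
    have := Real.sqrt_pos.2 Real.pi_pos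
    exact_mod_cast this.ne'
  push_cast
  field_simp

open scoped RealInnerProductSpace in
/-- `∫_{ℝ^d} ρ^{M,d}(x) e^{i⟨k,x⟩} dx = e^{-‖k‖²/4} L_M^{(d)}(‖k‖²/2)`. -/
theorem fermi_density_fourier_transform (d M : ℕ) (hd : 1 ≤ d)
    (k : EuclideanSpace ℝ (Fin d)) :
    ∫ x : EuclideanSpace ℝ (Fin d),
        (fermiDensity d M x : ℂ) * Complex.exp (Complex.I * (⟪k, x⟫ : ℝ)) =
      ((Real.exp (-‖k‖ ^ 2 / 4) * laguerreL M d (‖k‖ ^ 2 / 2) : ℝ) : ℂ) := by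
  have hinner : ∀ x : EuclideanSpace ℝ (Fin d), (⟪k, x⟫ : ℝ) = ∑ j, k j * x j := by
    intro x
    simp [PiLp.inner_apply, mul_comm]
  have hpt : ∀ x : EuclideanSpace ℝ (Fin d),
      (fermiDensity d M x : ℂ) * Complex.exp (Complex.I * (⟪k, x⟫ : ℝ)) =
      (fun y : Fin d → ℝ => ∑ l ∈ occ d M, ∏ j, ((((ψho (l j) (y j)) ^ 2 : ℝ) : ℂ) *
        Complex.exp (Complex.I * (k j * y j)))) (WithLp.ofLp x) := by
    intro x
    rw [hinner]
    simp only [Finset.prod_mul_distrib]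
    rw [← Finset.sum_mul, ← Complex.exp_sum, ← Finset.mul_sum]
    unfold fermiDensity occ
    push_cast
    rfl
  simp_rw [hpt]
  rw [(PiLp.volume_preserving_ofLp (Fin d)).integral_comp
    (MeasurableEquiv.toLp 2 (Fin d → ℝ)).symm.measurableEmbedding
    (fun y : Fin d → ℝ => ∑ l ∈ occ d M, ∏ j, ((((ψho (l j) (y j)) ^ 2 : ℝ) : ℂ) *
        Complex.exp (Complex.I * (k j * y j))))]
  rw [integral_finsetSum]
  · have h1 : ∀ l ∈ occ d M, ∫ y : Fin d → ℝ, ∏ j, ((((ψho (l j) (y j)) ^ 2 : ℝ) : ℂ) *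
        Complex.exp (Complex.I * (k j * y j)))
        = ((Real.exp (-‖k‖ ^ 2 / 4) * ∏ j, laguerreL (l j) 0 (k j ^ 2 / 2) : ℝ) : ℂ) := by
      intro l _
      rw [integral_fintype_prod_volume_eq_prod (fun j (y : ℝ) => (((ψho (l j) y) ^ 2 : ℝ) : ℂ) *
        Complex.exp (Complex.I * (k j * y)))]
      simp_rw [psi_fourier]
      rw [← Complex.ofReal_prod, Finset.prod_mul_distrib, ← Real.exp_sum, ← Finset.sum_div,
        Finset.sum_neg_distrib, EuclideanSpace.real_norm_sq_eq]
    rw [Finset.sum_congr rfl h1, ← Complex.ofReal_sum, ← Finset.mul_sum,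
      occ_sum d M (fun j => k j ^ 2 / 2), ← Finset.sum_div, EuclideanSpace.real_norm_sq_eq]
  · intro l _
    exact Integrable.fintype_prod (f := fun j (y : ℝ) => (((ψho (l j) y) ^ 2 : ℝ) : ℂ) *
        Complex.exp (Complex.I * (k j * y))) (fun j => psi_int (l j) (k j))
end

section
/- For every integer d ≥ 1 and integer M ≥ 0, the radial profile u(r) = ρ^{M,d}((r,0,…,0)) of the ground-state density satisfies, for all r > 0, the third order linear differential equation -(1/8) u'''(r) - ((d-1)/(8r)) u''(r) + ( (d-1)/(8r²) + r²/2 - (M + (d+1)/2) ) u'(r) - (d/2) r u(r) = 0. -/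
open MeasureTheory Real

namespace FermiAux

open PowerSeries

noncomputable def cc (l : ℕ) : ℝ := (2 ^ l * (Nat.factorial l) * Real.sqrt π)⁻¹

lemma cc_succ (l : ℕ) : cc l = 2 * (l + 1) * cc (l + 1) := by
  have : (Real.sqrt π) ≠ 0 := by positivity
  have h2 : (Nat.factorial l : ℝ) ≠ 0 := by positivity
  have h3 : (l : ℝ) + 1 ≠ 0 := by positivity
  unfold cc
  rw [Nat.factorial_succ]
  push_cast
  field_simp
  ring

lemma psi_sq (l : ℕ) (x : ℝ) : ψho l x ^ 2 = cc l * hermiteH l x ^ 2 * Real.exp (-x ^ 2) := by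
  unfold ψho cc
  rw [mul_pow, mul_pow, inv_pow, Real.sq_sqrt (by positivity), ← Real.exp_nat_mul]
  congr 2
  push_cast
  ring

lemma herm_rec (n : ℕ) (x : ℝ) :
    hermiteH (n + 2) x = 2 * x * hermiteH (n + 1) x - 2 * (n + 1) * hermiteH n x := by
  rw [hermiteH]

lemma herm_zero (x : ℝ) : hermiteH 0 x = 1 := by rw [hermiteH]

lemma herm_one (x : ℝ) : hermiteH 1 x = 2 * x := by rw [hermiteH]

lemma herm_deriv_aux (n : ℕ) : ∀ x : ℝ, HasDerivAt (hermiteH n) (2 * n * hermiteH (n - 1) x) x ∧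
    HasDerivAt (hermiteH (n + 1)) (2 * (n + 1) * hermiteH n x) x := by
  induction n with
  | zero =>
    intro x
    constructor
    · have : hermiteH 0 = fun _ => 1 := by funext y; exact herm_zero y
      rw [this]
      simpa using hasDerivAt_const x (1 : ℝ)
    · have : hermiteH (0 + 1) = fun y => 2 * y := by funext y; exact herm_one y
      rw [this, herm_zero]
      simpa using (hasDerivAt_id x).const_mul (2 : ℝ)
  | succ n ih =>
    intro x
    refine ⟨by simpa using (ih x).2, ?_⟩
    have e : hermiteH (n + 1 + 1) =
        fun x => 2 * x * hermiteH (n + 1) x - 2 * (n + 1) * hermiteH n x := by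
      funext y; exact herm_rec n y
    rw [e]
    have h1 := (((hasDerivAt_id x).const_mul (2 : ℝ)).mul (ih x).2).sub
      ((ih x).1.const_mul (2 * ((n : ℝ) + 1)))
    refine h1.congr_deriv ?_
    rcases n with _ | n
    · simp [herm_zero, herm_one]; ring
    · simp only [Nat.add_sub_cancel, id, herm_rec]
      push_cast
      ring

noncomputable def ff (l : ℕ) (x : ℝ) : ℝ := ψho l x ^ 2

/-- derivative of `ff` -/
noncomputable def fd (l : ℕ) (x : ℝ) : ℝ :=
  (cc l * (2 * hermiteH l x * (2 * l * hermiteH (l - 1) x)) - 2 * x * (cc l * hermiteH l x ^ 2))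
    * Real.exp (-x ^ 2)

lemma ff_deriv (l : ℕ) (x : ℝ) : HasDerivAt (ff l) (fd l x) x := by
  have e : ff l = fun x => cc l * hermiteH l x ^ 2 * Real.exp (-x ^ 2) := by
    funext y; exact psi_sq l y
  rw [e]
  have h1 := (((herm_deriv_aux l x).1.pow 2).const_mul (cc l)).mul
    (((hasDerivAt_id x).pow 2).neg.exp)
  refine h1.congr_deriv ?_
  simp [fd]
  ring

lemma fd_zero (x : ℝ) : fd 0 x = -2 * x * ff 0 x := by
  simp only [fd, ff, psi_sq, herm_zero]
  simp
  ring

lemma fd_succ (l : ℕ) (x : ℝ) : fd (l + 1) x + fd l x = -2 * x * (ff (l + 1) x - ff l x) := by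
  simp only [fd, ff, psi_sq, Nat.add_sub_cancel, cc_succ l]
  rcases l with _ | l
  · simp [herm_zero, herm_one]; ring
  · simp only [Nat.add_sub_cancel, herm_rec]
    push_cast
    ring

lemma ff_rec (n : ℕ) (x : ℝ) : (n + 3) * ff (n + 3) x + (n + 2) * ff (n + 2) x
    - (n + 2) * ff (n + 1) x - (n + 1) * ff n x = 2 * x ^ 2 * (ff (n + 2) x - ff (n + 1) x) := by
  simp only [ff, psi_sq, herm_rec (n + 1), herm_rec n, cc_succ n, cc_succ (n + 1), cc_succ (n + 2)]
  push_cast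
  ring

lemma ff_rec0 (x : ℝ) : ff 1 x = 2 * x ^ 2 * ff 0 x := by
  have := cc_succ 0
  simp only [ff, psi_sq, herm_one, herm_zero, this]
  push_cast
  ring

lemma ff_rec1 (x : ℝ) : 2 * ff 2 x + ff 1 x - ff 0 x = 2 * x ^ 2 * (ff 1 x - ff 0 x) := by
  have h0 := cc_succ 0
  have h1 := cc_succ 1
  have h2 := herm_rec 0 x
  norm_num at h0 h1 h2
  simp only [ff, psi_sq, h2, herm_one, herm_zero, h0, h1]
  ring

noncomputable def F (x : ℝ) : ℝ⟦X⟧ := mk fun l => ff l x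

noncomputable def E : ℝ⟦X⟧ := mk 1

noncomputable def S : ℝ⟦X⟧ := (1 + X)⁻¹

noncomputable def T : ℝ⟦X⟧ := (1 - X) * S

lemma E_eq : E * (1 - X) = 1 := mk_one_mul_one_sub_eq_one ℝ

lemma S_eq : S * (1 + X) = 1 := PowerSeries.inv_mul_cancel _ (by simp)

lemma dE : d⁄dX ℝ E = E ^ 2 := by
  have h := congrArg (d⁄dX ℝ) E_eq
  simp only [Derivation.leibniz, smul_eq_mul, map_sub, derivative_X, Derivation.map_one_eq_zero] at h
  linear_combination E * h - (d⁄dX ℝ E) * E_eq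

lemma dS : d⁄dX ℝ S = - S ^ 2 := by
  have h := congrArg (d⁄dX ℝ) S_eq
  simp only [Derivation.leibniz, smul_eq_mul, map_add, derivative_X, Derivation.map_one_eq_zero] at h
  linear_combination S * h - (d⁄dX ℝ S) * S_eq

lemma Fd_eq (x : ℝ) : (mk fun l => fd l x) = C (-2 * x) * (T * F x) := by
  have h : (1 + X) * (mk fun l => fd l x) = C (-2 * x) * ((1 - X) * F x) := by
    ext n
    rcases n with _ | n
    · simp [add_mul, sub_mul, F, fd_zero]
    · simp only [add_mul, sub_mul, one_mul, F, map_add, map_sub, coeff_C_mul, coeff_succ_X_mul,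
        coeff_mk]
      exact fd_succ n x
  unfold T
  linear_combination S * h - (mk fun l => fd l x) * S_eq

lemma dF_aux (x : ℝ) : (1 - X) * (1 + X) ^ 2 * d⁄dX ℝ (F x) =
    (X * (1 + X) + C (2 * x ^ 2) * (1 - X)) * F x := by
  have : (1 : ℝ⟦X⟧) * d⁄dX ℝ (F x) + X * d⁄dX ℝ (F x) - X * (X * d⁄dX ℝ (F x))
      - X * (X * (X * d⁄dX ℝ (F x))) = X * F x + X * (X * F x) + C (2 * x ^ 2) * F x -
        C (2 * x ^ 2) * (X * F x) := by
    ext n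
    rcases n with _ | _ | _ | n
    · simp only [one_mul, map_add, map_sub, coeff_C_mul, coeff_zero_X_mul, coeff_derivative, F,
        coeff_mk]
      have := ff_rec0 x
      push_cast
      linear_combination this
    · simp only [one_mul, map_add, map_sub, coeff_C_mul, coeff_zero_X_mul, coeff_succ_X_mul,
        coeff_derivative, F, coeff_mk]
      have := ff_rec1 x
      push_cast
      linear_combination this
    · simp only [one_mul, map_add, map_sub, coeff_C_mul, coeff_zero_X_mul, coeff_succ_X_mul,
        coeff_derivative, F, coeff_mk]
      have := ff_rec 0 x
      push_cast at this ⊢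
      linear_combination this
    · simp only [one_mul, map_add, map_sub, coeff_C_mul, coeff_zero_X_mul, coeff_succ_X_mul,
        coeff_derivative, F, coeff_mk]
      have := ff_rec (n + 1) x
      push_cast at this ⊢
      linear_combination this
  linear_combination this

lemma dF (x : ℝ) : d⁄dX ℝ (F x) = (X * E * S + C (2 * x ^ 2) * S ^ 2) * F x := by
  have hE := E_eq
  have hS := S_eq
  have h := dF_aux x
  have h1 : E * S ^ 2 * ((1 - X) * (1 + X) ^ 2 * d⁄dX ℝ (F x)) = d⁄dX ℝ (F x) := by
    calc _ = (E * (1 - X)) * (S * (1 + X)) ^ 2 * d⁄dX ℝ (F x) := by ring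
      _ = _ := by rw [hE, hS]; ring
  rw [← h1, h]
  calc _ = (X * E * S * (S * (1 + X)) + C (2 * x ^ 2) * S ^ 2 * (E * (1 - X))) * F x := by ring
    _ = _ := by rw [hE, hS]; ring

lemma dK (n : ℕ) : d⁄dX ℝ (F 0 ^ n) = C (n : ℝ) * (X * E * S) * F 0 ^ n := by
  induction n with
  | zero => simp
  | succ n ih =>
    rw [pow_succ, Derivation.leibniz, ih, dF]
    simp only [smul_eq_mul]
    push_cast
    simp
    ring

noncomputable def G (n : ℕ) (x : ℝ) : ℝ⟦X⟧ := F x * (F 0 ^ n * E)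

lemma dG (n : ℕ) (x : ℝ) : d⁄dX ℝ (G n x) =
    (C ((n : ℝ) + 1) * (X * E * S) + C (2 * x ^ 2) * S ^ 2 + E) * G n x := by
  unfold G
  rw [Derivation.leibniz, Derivation.leibniz, dF, dK, dE]
  simp only [smul_eq_mul, map_add, map_one]
  ring

lemma T_eq : T = 2 * S - 1 := by
  have := S_eq
  unfold T
  linear_combination -this

lemma dTG (n : ℕ) (x : ℝ) : d⁄dX ℝ (T * G n x) =
    (-2 * S ^ 2 + C ((n : ℝ) + 1) * X * S ^ 2 + S + C (2 * x ^ 2) * S ^ 2 * T) * G n x := by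
  have hT : T * E = S := by
    unfold T; linear_combination S * E_eq
  have dT : d⁄dX ℝ T = - 2 * S ^ 2 := by
    unfold T
    simp only [Derivation.leibniz, smul_eq_mul, map_sub, derivative_X,
      Derivation.map_one_eq_zero, dS]
    linear_combination S * S_eq
  rw [Derivation.leibniz, dG, dT]
  simp only [smul_eq_mul]
  linear_combination ((C ((n : ℝ) + 1) * X * S) + 1) * G n x * hT

lemma main_ps (n : ℕ) (x : ℝ) : C (2 * x ^ 2) * (T ^ 3 * G n x) - C (2 * x ^ 2) * (T * G n x)
    - C ((n : ℝ) + 3) * (T ^ 2 * G n x) + C (2 * ((n : ℝ) + 2)) * (T * G n x)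
    - C ((n : ℝ) + 1) * G n x + C 4 * (X * d⁄dX ℝ (T * G n x)) = 0 := by
  rw [dTG]
  have h1 : X * S = 1 - S := by linear_combination S_eq
  have e : X * ((-2 * S ^ 2 + C ((n : ℝ) + 1) * X * S ^ 2 + S + C (2 * x ^ 2) * S ^ 2 * T) * G n x)
      = (-2 * S * (1 - S) + C ((n : ℝ) + 1) * (1 - S) ^ 2 + (1 - S)
        + C (2 * x ^ 2) * S * (1 - S) * T) * G n x := by
    rw [← h1]; ring
  rw [e, T_eq]
  have h4 : (C 4 : ℝ⟦X⟧) = 4 := map_ofNat _ _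
  have h3 : (C 3 : ℝ⟦X⟧) = 3 := map_ofNat _ _
  have h2 : (C 2 : ℝ⟦X⟧) = 2 := map_ofNat _ _
  simp only [map_add, map_mul, map_one, h2, h3, h4]
  ring

lemma hasDerivAt_coeff_mul (A : ℝ → ℝ⟦X⟧) (B P : ℝ⟦X⟧) (x : ℝ)
    (h : ∀ n, HasDerivAt (fun y => coeff n (A y)) (coeff n B) x) (M : ℕ) :
    HasDerivAt (fun y => coeff M (A y * P)) (coeff M (B * P)) x := by
  simp only [coeff_mul]
  exact HasDerivAt.fun_sum fun p _ => (h p.1).mul_const _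

noncomputable def v (n M k : ℕ) (x : ℝ) : ℝ := coeff M (T ^ k * G n x)

lemma v_deriv (n M k : ℕ) (x : ℝ) : HasDerivAt (v n M k) (-2 * x * v n M (k + 1) x) x := by
  have h := hasDerivAt_coeff_mul F (mk fun l => fd l x) (F 0 ^ n * E * T ^ k) x
    (fun l => by simpa [F] using ff_deriv l x) M
  have e : v n M k = fun y => coeff M (F y * (F 0 ^ n * E * T ^ k)) := by
    funext y
    unfold v G
    congr 1
    ring
  rw [e]
  refine h.congr_deriv ?_
  rw [Fd_eq, v, ← coeff_C_mul]
  congr 1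
  unfold G
  ring

lemma density_eq (n M : ℕ) (r : ℝ) (h : 0 < n + 1) :
    fermiDensity (n + 1) M (EuclideanSpace.single (⟨0, h⟩ : Fin (n + 1)) r) = v n M 0 r := by
  set x := EuclideanSpace.single (⟨0, h⟩ : Fin (n + 1)) r with hx
  have hG : T ^ 0 * G n r = (∏ j : Fin (n + 1), F (x j)) * E := by
    rw [Fin.prod_univ_succ]
    have h0 : x 0 = r := by simp [hx]
    have h1 : ∀ j : Fin n, x j.succ = 0 := by
      intro j
      simp [hx, Fin.ext_iff]
    simp [h0, h1, G, mul_assoc]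
  unfold v fermiDensity
  rw [hG, coeff_mul, Finset.Nat.sum_antidiagonal_eq_sum_range_succ_mk]
  simp only [E, coeff_mk, Pi.one_apply, mul_one, coeff_prod, F]
  symm
  rw [Finset.sum_sigma']
  refine Finset.sum_bij' (fun p _ => (p.2 : Fin (n + 1) → ℕ))
    (fun l _ => ⟨∑ j, l j, Finsupp.equivFunOnFinite.symm l⟩) ?_ ?_ ?_ ?_ ?_
  · rintro ⟨s, l⟩ hl
    simp only [Finset.mem_sigma, Finset.mem_range, Finset.mem_finsuppAntidiag] at hl
    obtain ⟨h1, h2, -⟩ := hl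
    change ∑ j, l j = s at h2
    simp only [Finset.mem_filter, Fintype.mem_piFinset, Finset.mem_range]
    refine ⟨fun j => ?_, by omega⟩
    have := Finset.single_le_sum (f := fun j => l j) (fun i _ => Nat.zero_le _) (Finset.mem_univ j)
    omega
  · intro l hl
    simp only [Finset.mem_filter] at hl
    simp only [Finset.mem_sigma, Finset.mem_range, Finset.mem_finsuppAntidiag]
    refine ⟨by omega, by simp, by simp⟩
  · rintro ⟨s, l⟩ hl
    simp only [Finset.mem_sigma, Finset.mem_range, Finset.mem_finsuppAntidiag] at hl
    obtain ⟨h1, rfl, -⟩ := hl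
    simp
  · intro l hl
    simp
  · rintro ⟨s, l⟩ hl
    simp [ff]

lemma coeff_X_deriv (P : ℝ⟦X⟧) (M : ℕ) : coeff M (X * d⁄dX ℝ P) = M * coeff M P := by
  rcases M with _ | M
  · simp
  · rw [coeff_succ_X_mul, coeff_derivative]
    push_cast
    ring

end FermiAux

/-- the radial profile `u(r) = ρ^{M,d}((r,0,…,0))` satisfies, for `r > 0`,
`-(1/8) u''' - ((d-1)/(8r)) u'' + ((d-1)/(8r²) + r²/2 - (M+(d+1)/2)) u' - (d/2) r u = 0`. -/
theorem fermi_density_third_order_ODE (d M : ℕ) (hd : 1 ≤ d)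
    (u : ℝ → ℝ)
    (hu : ∀ r : ℝ, u r = fermiDensity d M (EuclideanSpace.single (⟨0, hd⟩ : Fin d) r)) :
    ∀ r : ℝ, 0 < r →
      -(1 / 8) * deriv (deriv (deriv u)) r - (((d : ℝ) - 1) / (8 * r)) * deriv (deriv u) r +
        (((d : ℝ) - 1) / (8 * r ^ 2) + r ^ 2 / 2 - ((M : ℝ) + ((d : ℝ) + 1) / 2)) * deriv u r -
          ((d : ℝ) / 2) * r * u r = 0 := by
  obtain ⟨n, rfl⟩ : ∃ n, d = n + 1 := ⟨d - 1, by omega⟩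
  have hu' : u = FermiAux.v n M 0 := by
    funext r
    rw [hu r]
    exact FermiAux.density_eq n M r _
  intro r hr
  have d1 : deriv u = fun r => -2 * r * FermiAux.v n M 1 r := by
    funext r
    rw [hu']
    exact (FermiAux.v_deriv n M 0 r).deriv
  have d2 : deriv (deriv u) = fun r => -2 * FermiAux.v n M 1 r + 4 * r ^ 2 * FermiAux.v n M 2 r := by
    funext r
    rw [d1]
    have h := ((hasDerivAt_id r).const_mul (-2 : ℝ)).mul (FermiAux.v_deriv n M 1 r)
    refine h.deriv.trans ?_
    simp
    ring
  have d3 : deriv (deriv (deriv u)) r =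
      12 * r * FermiAux.v n M 2 r - 8 * r ^ 3 * FermiAux.v n M 3 r := by
    rw [d2]
    have h := ((FermiAux.v_deriv n M 1 r).const_mul (-2 : ℝ)).add
      ((((hasDerivAt_id r).pow 2).const_mul (4 : ℝ)).mul (FermiAux.v_deriv n M 2 r))
    refine h.deriv.trans ?_
    simp
    ring
  have key := congrArg (PowerSeries.coeff M) (FermiAux.main_ps n r)
  simp only [LinearMap.map_add, LinearMap.map_sub, PowerSeries.coeff_C_mul, FermiAux.coeff_X_deriv, map_zero] at key
  have e0 : FermiAux.v n M 0 r = PowerSeries.coeff M (FermiAux.G n r) := by simp [FermiAux.v]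
  have e1 : FermiAux.v n M 1 r = PowerSeries.coeff M (FermiAux.T * FermiAux.G n r) := by
    simp [FermiAux.v]
  have e2 : FermiAux.v n M 2 r = PowerSeries.coeff M (FermiAux.T ^ 2 * FermiAux.G n r) := rfl
  have e3 : FermiAux.v n M 3 r = PowerSeries.coeff M (FermiAux.T ^ 3 * FermiAux.G n r) := rfl
  rw [← e0, ← e1, ← e2, ← e3] at key
  rw [d3, d2, d1, hu']
  push_cast
  have hr' : r ≠ 0 := hr.ne'
  field_simp
  linear_combination (8 * r ^ 2) * key
end

section
/- For every integer d ≥ 1 and integer M ≥ 0, the radial profile u(r) = ρ^{M,d}((r,0,…,0)) of the ground-state density satisfies, for all r > 0, the integro-differential equation -(1/8)( u''(r) + ((d-1)/r) u'(r) ) + (r²/2) u(r) + ((d+2)/2) ∫_r^∞ s u(s) ds = (M + (d+1)/2) u(r). -/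
open MeasureTheory Real

lemma fd_H_deriv (n : ℕ) (x : ℝ) :
    HasDerivAt (hermiteH n) (2 * x * hermiteH n x - hermiteH (n + 1) x) x := by
  induction n using Nat.strong_induction_on with
  | _ n ih =>
    match n with
    | 0 =>
      have := hasDerivAt_const x (1 : ℝ)
      simpa [hermiteH] using this
    | 1 =>
      have := (hasDerivAt_id x).const_mul 2
      simp only [hermiteH]
      refine this.congr_deriv ?_
      norm_num
    | (k + 2) =>
      have h1 := ih (k + 1) (by omega)
      have h0 := ih k (by omega)
      have h2 := ((((hasDerivAt_id x).const_mul 2).mul h1).sub (h0.const_mul (2 * ((k : ℝ) + 1))))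
      have e : hermiteH (k + 2) =
          ((fun y => 2 * id y) * hermiteH (k + 1) - fun y => 2 * ((k : ℝ) + 1) * hermiteH k y) := by
        funext y; simp [hermiteH]
      rw [e]
      refine h2.congr_deriv ?_
      have e3 : hermiteH (k + 2 + 1) x =
        2 * x * hermiteH (k + 2) x - 2 * ((k : ℝ) + 2) * hermiteH (k + 1) x := by
        simp only [hermiteH]; push_cast; ring
      have e2 : hermiteH (k + 2) x =
        2 * x * hermiteH (k + 1) x - 2 * ((k : ℝ) + 1) * hermiteH k x := by
        simp only [hermiteH]
      rw [e3, e2]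
      simp
      ring

/-- squared eigenfunctions -/
noncomputable def fdA (l : ℕ) (x : ℝ) : ℝ := ψho l x ^ 2

lemma fdA_eq (l : ℕ) (x : ℝ) :
    fdA l x = (2 ^ l * (Nat.factorial l) * Real.sqrt π)⁻¹ * (hermiteH l x ^ 2 * Real.exp (-x ^ 2)) := by
  unfold fdA ψho
  rw [mul_pow, mul_pow, inv_pow, Real.sq_sqrt (by positivity), ← Real.exp_nat_mul, mul_assoc]
  congr 3
  push_cast; ring

noncomputable def fdA1 (l : ℕ) (x : ℝ) : ℝ :=
  (2 ^ l * (Nat.factorial l) * Real.sqrt π)⁻¹ *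
    ((2 * x * hermiteH l x ^ 2 - 2 * hermiteH l x * hermiteH (l + 1) x) * Real.exp (-x ^ 2))

lemma fdA_deriv (l : ℕ) (x : ℝ) : HasDerivAt (fdA l) (fdA1 l x) x := by
  have e : fdA l = fun y => (2 ^ l * (Nat.factorial l) * Real.sqrt π)⁻¹ *
      (hermiteH l y ^ 2 * Real.exp (-y ^ 2)) := funext (fdA_eq l)
  rw [e]
  have h1 := (fd_H_deriv l x).fun_pow 2
  have h2 : HasDerivAt (fun y : ℝ => Real.exp (-y ^ 2)) (Real.exp (-x ^ 2) * (-(2 * x))) x := by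
    have := ((hasDerivAt_id x).fun_pow 2).fun_neg.exp
    simpa using this
  refine ((h1.mul h2).const_mul _).congr_deriv ?_
  unfold fdA1
  push_cast
  ring

lemma fdA1_rec (l : ℕ) (x : ℝ) :
    fdA1 (l + 1) x + fdA1 l x = -(2 * x) * (fdA (l + 1) x - fdA l x) := by
  simp only [fdA1, fdA_eq, hermiteH]
  have h : Real.sqrt π ≠ 0 := by positivity
  have h' : (Nat.factorial l : ℝ) ≠ 0 := by positivity
  rw [Nat.factorial_succ]
  push_cast
  field_simp
  ring

lemma fdA1_zero (x : ℝ) : fdA1 0 x = -(2 * x) * fdA 0 x := by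
  simp only [fdA1, fdA_eq, hermiteH]
  ring

lemma fdA_rec0 (x : ℝ) : fdA 1 x = 2 * x ^ 2 * fdA 0 x := by
  simp only [fdA_eq, hermiteH]
  simp
  field_simp

lemma fdA_rec1 (x : ℝ) : 2 * fdA 2 x + fdA 1 x = fdA 0 x + 2 * x ^ 2 * (fdA 1 x - fdA 0 x) := by
  simp only [fdA_eq, hermiteH]
  simp [Nat.factorial]
  field_simp
  ring

lemma fdA_rec (n : ℕ) (x : ℝ) :
    ((n : ℝ) + 3) * fdA (n + 3) x + ((n : ℝ) + 2) * fdA (n + 2) x =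
      2 * x ^ 2 * (fdA (n + 2) x - fdA (n + 1) x) + ((n : ℝ) + 2) * fdA (n + 1) x
        + ((n : ℝ) + 1) * fdA n x := by
  simp only [fdA_eq, hermiteH]
  have h : Real.sqrt π ≠ 0 := by positivity
  have h' : (Nat.factorial n : ℝ) ≠ 0 := by positivity
  rw [Nat.factorial_succ (n + 2), Nat.factorial_succ (n + 1), Nat.factorial_succ n]
  push_cast
  have h1 : (n : ℝ) + 1 ≠ 0 := by positivity
  have h2 : (n : ℝ) + 1 + 1 ≠ 0 := by positivity
  have h3 : (n : ℝ) + 2 + 1 ≠ 0 := by positivity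
  field_simp
  ring

open Filter Topology in
lemma fd_H_tendsto (n k : ℕ) :
    Tendsto (fun x => x ^ k * (hermiteH n x * Real.exp (-x ^ 2 / 2))) atTop (𝓝 0) := by
  induction n using Nat.strong_induction_on generalizing k with
  | _ n ih =>
    have base : ∀ k : ℕ, Tendsto (fun x : ℝ => x ^ k * Real.exp (-x ^ 2 / 2)) atTop (𝓝 0) := by
      intro k
      have h := Real.tendsto_pow_mul_exp_neg_atTop_nhds_zero k
      refine squeeze_zero' ?_ ?_ h
      · filter_upwards [eventually_ge_atTop 0] with x hx
        positivity
      · filter_upwards [eventually_ge_atTop 2] with x hx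
        have : -x ^ 2 / 2 ≤ -x := by nlinarith
        gcongr
    match n with
    | 0 => simpa [hermiteH] using base k
    | 1 =>
      have := (base (k + 1)).const_mul 2
      rw [mul_zero] at this
      refine this.congr fun x => ?_
      simp only [hermiteH]; ring
    | (m + 2) =>
      have h1 := (ih (m + 1) (by omega) (k + 1)).const_mul 2
      have h0 := (ih m (by omega) k).const_mul (2 * ((m : ℝ) + 1))
      have := h1.sub h0
      simp only [mul_zero, sub_zero] at this
      refine this.congr fun x => ?_
      simp only [hermiteH]; ring

open Filter Topology in
lemma fdA_tendsto (n : ℕ) : Tendsto (fdA n) atTop (𝓝 0) := by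
  have h := ((fd_H_tendsto n 0).const_mul
    ((Real.sqrt (2 ^ n * (Nat.factorial n) * Real.sqrt π))⁻¹)).pow 2
  simp only [mul_zero, ne_eq, OfNat.ofNat_ne_zero, not_false_eq_true, zero_pow] at h
  refine h.congr fun x => ?_
  simp only [fdA, ψho]; ring

open PowerSeries

noncomputable def fdG (x : ℝ) : PowerSeries ℝ := PowerSeries.mk fun l => fdA l x

noncomputable def fdG1 (x : ℝ) : PowerSeries ℝ := PowerSeries.mk fun l => fdA1 l x

lemma fdG1_eq (x : ℝ) : (1 + X) * fdG1 x = C (-(2 * x)) * ((1 - X) * fdG x) := by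
  ext n
  rw [add_mul, sub_mul, one_mul, one_mul]
  rcases n with _ | n
  · simp only [map_add, map_sub, PowerSeries.coeff_C_mul, PowerSeries.coeff_zero_X_mul, fdG, fdG1,
      PowerSeries.coeff_mk]
    simpa using fdA1_zero x
  · simp only [map_add, map_sub, PowerSeries.coeff_C_mul, PowerSeries.coeff_succ_X_mul, fdG, fdG1,
      PowerSeries.coeff_mk]
    exact fdA1_rec n x

lemma fdG_ode (x : ℝ) : (1 - X) * (1 + X) ^ 2 * d⁄dX ℝ (fdG x) =
    (X * (1 + X) + C (2 * x ^ 2) * (1 - X)) * fdG x := by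
  have e1 : (1 - X) * (1 + X) ^ 2 * d⁄dX ℝ (fdG x) = d⁄dX ℝ (fdG x) + X * d⁄dX ℝ (fdG x)
    - X * (X * d⁄dX ℝ (fdG x)) - X * (X * (X * d⁄dX ℝ (fdG x))) := by ring
  have e2 : (X * (1 + X) + C (2 * x ^ 2) * (1 - X)) * fdG x =
    X * fdG x + X * (X * fdG x) + C (2 * x ^ 2) * (fdG x - X * fdG x) := by ring
  rw [e1, e2]
  ext n
  rcases n with _ | _ | n
  · have := fdA_rec0 x
    simp only [map_add, map_sub, PowerSeries.coeff_C_mul, PowerSeries.coeff_zero_X_mul,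
      fdG, PowerSeries.coeff_mk, PowerSeries.coeff_derivative]
    push_cast
    linear_combination this
  · have := fdA_rec1 x
    simp only [map_add, map_sub, PowerSeries.coeff_C_mul, PowerSeries.coeff_zero_X_mul,
      PowerSeries.coeff_succ_X_mul, 
      fdG, PowerSeries.coeff_mk, PowerSeries.coeff_derivative]
    push_cast
    norm_num
    linear_combination this
  · have := fdA_rec n x
    rcases n with _ | n
    · simp only [map_add, map_sub, PowerSeries.coeff_C_mul, PowerSeries.coeff_zero_X_mul,
        PowerSeries.coeff_succ_X_mul, 
        fdG, PowerSeries.coeff_mk, PowerSeries.coeff_derivative]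
      push_cast at this ⊢
      norm_num at this ⊢
      linear_combination this
    · simp only [map_add, map_sub, PowerSeries.coeff_C_mul, 
        PowerSeries.coeff_succ_X_mul, 
        fdG, PowerSeries.coeff_mk, PowerSeries.coeff_derivative]
      push_cast at this ⊢
      linear_combination this

lemma fd_inv_add : (1 + X : PowerSeries ℝ) * (1 + X)⁻¹ = 1 :=
  PowerSeries.mul_inv_cancel _ (by simp)

lemma fd_inv_sub : (1 - X : PowerSeries ℝ) * (1 - X)⁻¹ = 1 :=
  PowerSeries.mul_inv_cancel _ (by simp)

noncomputable def fdR : PowerSeries ℝ := (1 - X) * (1 + X)⁻¹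

lemma fdR_eq : (1 + X) * fdR = 1 - X := by
  unfold fdR; linear_combination (1 - X) * fd_inv_add

lemma fdG1_eq' (x : ℝ) : fdG1 x = C (-(2 * x)) * (fdR * fdG x) := by
  unfold fdR
  linear_combination (1 + X)⁻¹ * fdG1_eq x - fdG1 x * fd_inv_add

lemma fd_deriv (Q : PowerSeries ℝ) (M : ℕ) (x : ℝ) :
    HasDerivAt (fun y => coeff M (Q * fdG y)) (-(2 * x) * coeff M (Q * fdR * fdG x)) x := by
  have e : -(2 * x) * coeff M (Q * fdR * fdG x) = coeff M (Q * fdG1 x) := by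
    rw [fdG1_eq', ← PowerSeries.coeff_C_mul]
    congr 1; ring
  rw [e]
  simp only [PowerSeries.coeff_mul]
  refine HasDerivAt.fun_sum fun p _ => ?_
  simp only [fdG, fdG1, PowerSeries.coeff_mk]
  exact (fdA_deriv p.2 x).const_mul _

open Filter Topology in
lemma fd_tendsto (Q : PowerSeries ℝ) (M : ℕ) :
    Tendsto (fun y => coeff M (Q * fdG y)) atTop (𝓝 0) := by
  simp only [PowerSeries.coeff_mul]
  rw [← Finset.sum_const_zero (s := Finset.HasAntidiagonal.antidiagonal M)]
  refine tendsto_finsetSum _ fun p _ => ?_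
  simp only [fdG, PowerSeries.coeff_mk]
  simpa using (fdA_tendsto p.2).const_mul (coeff p.1 Q)

lemma fd_density (d M : ℕ) (x : EuclideanSpace ℝ (Fin d)) :
    fermiDensity d M x = coeff M ((1 - X)⁻¹ * ∏ j, fdG (x j)) := by
  have e : ((1 - X)⁻¹ : PowerSeries ℝ) = PowerSeries.mk 1 := by
    have h := PowerSeries.mk_one_mul_one_sub_eq_one ℝ
    linear_combination (PowerSeries.mk 1) * fd_inv_sub - (1 - X)⁻¹ * h
  rw [e, mul_comm, PowerSeries.coeff_mul]
  simp only [PowerSeries.coeff_mk, Pi.one_apply, mul_one]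
  rw [Finset.Nat.sum_antidiagonal_eq_sum_range_succ (fun i _ => coeff i (∏ j, fdG (x j)))]
  simp only [PowerSeries.coeff_prod, fdG, PowerSeries.coeff_mk]
  unfold fermiDensity
  rw [Finset.sum_sigma' ]
  refine Finset.sum_bij' (fun l _ => ⟨∑ j, l j, Finsupp.equivFunOnFinite.symm l⟩)
    (fun p _ => ⇑p.2) ?_ ?_ ?_ ?_ ?_
  · intro l hl
    simp at hl ⊢
    omega
  · rintro ⟨n, l⟩ hl
    simp [Finset.mem_finsuppAntidiag] at hl ⊢
    obtain ⟨h1, h2⟩ := hl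
    have h3 : ∑ j, l j ≤ M := by
      have : ∑ j, l j = n := h2
      omega
    refine ⟨fun a => ?_, h3⟩
    have := Finset.single_le_sum (f := fun j => l j) (fun i _ => Nat.zero_le _) (Finset.mem_univ a)
    have h4 : l a ≤ ∑ j, l j := this
    omega
  · intro l hl
    simp
  · rintro ⟨n, l⟩ hl
    simp [Finset.mem_finsuppAntidiag] at hl ⊢
    exact hl.2
  · intro l hl
    simp [fdA]

theorem fermi_density_integro_differential_equation (d M : ℕ) (hd : 1 ≤ d)
    (u : ℝ → ℝ)
    (hu : ∀ r : ℝ, u r = fermiDensity d M (EuclideanSpace.single (⟨0, hd⟩ : Fin d) r)) :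
    ∀ r : ℝ, 0 < r →
      -(1 / 8) * (deriv (deriv u) r + (((d : ℝ) - 1) / r) * deriv u r) +
        (r ^ 2 / 2) * u r + (((d : ℝ) + 2) / 2) * ∫ s in Set.Ioi r, s * u s =
          ((M : ℝ) + ((d : ℝ) + 1) / 2) * u r := by
  obtain ⟨n, rfl⟩ : ∃ n, d = n + 1 := ⟨d - 1, by omega⟩
  intro r hr
  obtain ⟨Q, hQ⟩ : ∃ Q : PowerSeries ℝ, Q = (1 - X)⁻¹ * fdG 0 ^ n := ⟨_, rfl⟩
  have hu' : ∀ x, u x = coeff M (Q * fdG x) := by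
    intro x
    rw [hu, fd_density, hQ, Fin.prod_univ_succ]
    congr 1
    have : ∀ i : Fin n, (EuclideanSpace.single (⟨0, hd⟩ : Fin (n + 1)) x) i.succ = 0 := by
      intro i
      simp [Fin.ext_iff]
    simp only [this]
    have h0 : (EuclideanSpace.single (⟨0, hd⟩ : Fin (n + 1)) x) 0 = x := by
      simp
    rw [h0]
    simp
    ring
  have hun : ∀ x, 0 ≤ u x := by
    intro x
    rw [hu]
    unfold fermiDensity
    positivity
  have huf : u = fun x => coeff M (Q * fdG x) := funext hu'
  have hd1 : deriv u = fun x => -(2 * x) * coeff M (Q * fdR * fdG x) := by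
    funext x
    rw [huf]
    exact (fd_deriv Q M x).deriv
  have hd2 : deriv (deriv u) r = -2 * coeff M (Q * fdR * fdG r)
      + 4 * r ^ 2 * coeff M (Q * fdR * fdR * fdG r) := by
    rw [hd1]
    have h1 : HasDerivAt (fun x : ℝ => -(2 * x)) (-2) r := by
      simpa using ((hasDerivAt_id r).const_mul 2).fun_neg
    rw [(h1.fun_mul (fd_deriv (Q * fdR) M r)).deriv]
    ring
  obtain ⟨S, hS⟩ : ∃ S : PowerSeries ℝ, S = C (1/2) * ((1 + X) * (1 - X)⁻¹) := ⟨_, rfl⟩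
  have h2 : (C (1/2) : PowerSeries ℝ) * 2 = 1 := by
    rw [show (2 : PowerSeries ℝ) = C 2 from rfl, ← map_mul]; norm_num
  have hSR : S * fdR = C (1/2) := by
    rw [hS]
    linear_combination C (1/2) * (1 - X)⁻¹ * fdR_eq + C (1/2) * fd_inv_sub
  have hint : ∫ s in Set.Ioi r, s * u s = coeff M (Q * S * fdG r) := by
    have hder : ∀ x, HasDerivAt (fun y => coeff M (Q * S * fdG y)) (-(x * u x)) x := by
      intro x
      refine (fd_deriv (Q * S) M x).congr_deriv ?_
      rw [hu', show Q * S * fdR * fdG x = C (1/2) * (Q * fdG x) by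
        linear_combination Q * fdG x * hSR, PowerSeries.coeff_C_mul]
      ring
    have := integral_Ioi_of_hasDerivAt_of_nonpos' (a := r) (fun x _ => hder x)
      (fun x hx => by
        have hx' : r < x := hx
        have := mul_nonneg (hr.trans hx').le (hun x)
        linarith) (fd_tendsto (Q * S) M)
    rw [integral_neg] at this
    linarith
  rw [hd2, hint, hd1, hu']
  have hr' : r ≠ 0 := hr.ne'
  -- power series identity
  have hG0 : (1 - X) * (1 + X) ^ 2 * d⁄dX ℝ (fdG 0) = X * (1 + X) * fdG 0 := by
    have := fdG_ode 0
    simpa using this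
  have hpow : (1 - X) * (1 + X) ^ 2 * d⁄dX ℝ (fdG 0 ^ n) = C (n : ℝ) * X * (1 + X) * fdG 0 ^ n := by
    rw [Derivation.leibniz_pow]
    rcases n with _ | n
    · simp
    · simp only [Nat.add_sub_cancel, smul_eq_mul, nsmul_eq_mul, map_natCast]
      linear_combination ((n + 1 : ℕ) : PowerSeries ℝ) * fdG 0 ^ n * hG0
  have hP : (1 - X) * (Q * fdG r) = fdG 0 ^ n * fdG r := by
    rw [hQ]; linear_combination (fdG 0 ^ n * fdG r) * fd_inv_sub
  obtain ⟨F, hF⟩ : ∃ F, F = Q * fdG r := ⟨_, rfl⟩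
  have hP' := congrArg (d⁄dX ℝ) hP
  rw [← hF] at hP hP'
  have hX : d⁄dX ℝ (1 - X : PowerSeries ℝ) = -1 := by simp
  simp only [Derivation.leibniz, smul_eq_mul, hX] at hP'
  have hsub : (1 - X : PowerSeries ℝ) ≠ 0 := fun h => by
    have := fd_inv_sub; rw [h] at this; simp at this
  have hadd : (1 + X : PowerSeries ℝ) ≠ 0 := fun h => by
    have := fd_inv_add; rw [h] at this; simp at this
  have hF' : (1 - X) * (1 + X) ^ 2 * d⁄dX ℝ F =
      (C ((n : ℝ) + 1) * X * (1 + X) + C (2 * r ^ 2) * (1 - X) + (1 + X) ^ 2) * F := by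
    apply mul_left_cancel₀ hsub
    rw [map_add, map_one]
    linear_combination (1 - X) * (1 + X) ^ 2 * hP' + fdG r * hpow + fdG 0 ^ n * fdG_ode r
      - (C (n : ℝ) * X * (1 + X) + X * (1 + X) + C (2 * r ^ 2) * (1 - X)) * hP
  have key : C (((n : ℝ) + 1) / 4) * (fdR * F) - C (r ^ 2 / 2) * (fdR * fdR * F) + C (r ^ 2 / 2) * F
      + C (((n : ℝ) + 3) / 2) * (S * F) = X * d⁄dX ℝ F + C (((n : ℝ) + 2) / 2) * F := by
    obtain ⟨c, hc⟩ : ∃ c : PowerSeries ℝ, c = C (n : ℝ) := ⟨_, rfl⟩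
    obtain ⟨q, hq⟩ : ∃ q : PowerSeries ℝ, q = C (1 / 4 : ℝ) := ⟨_, rfl⟩
    obtain ⟨t, ht⟩ : ∃ t : PowerSeries ℝ, t = C (r ^ 2) := ⟨_, rfl⟩
    have h4 : q * 4 = 1 := by
      rw [hq, show (4 : PowerSeries ℝ) = C 4 from rfl, ← map_mul]; norm_num
    have a1 : (C (((n : ℝ) + 1) / 4) : PowerSeries ℝ) = (c + 1) * q := by
      rw [hc, hq, ← map_one C, ← map_add, ← map_mul]; congr 1; ring
    have a2 : (C (r ^ 2 / 2) : PowerSeries ℝ) = 2 * t * q := by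
      rw [ht, hq, show (2 : PowerSeries ℝ) = C 2 from rfl, ← map_mul, ← map_mul]; congr 1; ring
    have a3 : (C (((n : ℝ) + 3) / 2) : PowerSeries ℝ) = 2 * (c + 3) * q := by
      rw [hc, hq, show (2 : PowerSeries ℝ) = C 2 from rfl, show (3 : PowerSeries ℝ) = C 3 from rfl,
        ← map_add, ← map_mul, ← map_mul]; congr 1; ring
    have a4 : (C (((n : ℝ) + 2) / 2) : PowerSeries ℝ) = 2 * (c + 2) * q := by
      rw [hc, hq, show (2 : PowerSeries ℝ) = C 2 from rfl,
        ← map_add, ← map_mul, ← map_mul]; congr 1; ring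
    have a5 : (C ((n : ℝ) + 1) : PowerSeries ℝ) = c + 1 := by
      rw [hc, ← map_one C, ← map_add]
    have a6 : (C (2 * r ^ 2) : PowerSeries ℝ) = 2 * t := by
      rw [ht, show (2 : PowerSeries ℝ) = C 2 from rfl, ← map_mul]
    have hS' : (1 - X) * S = 2 * q * (1 + X) := by
      have : (C (1 / 2) : PowerSeries ℝ) = 2 * q := by
        rw [hq, show (2 : PowerSeries ℝ) = C 2 from rfl, ← map_mul]; congr 1; ring
      rw [hS, this]; linear_combination 2 * q * (1 + X) * fd_inv_sub
    rw [a5, a6] at hF'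
    rw [a1, a2, a3, a4]
    apply mul_left_cancel₀ (mul_ne_zero hsub (pow_ne_zero 2 hadd))
    have hRR : (1 + X) ^ 2 * (fdR * fdR) = (1 - X) ^ 2 := by
      linear_combination ((1 + X) * fdR + 1 - X) * fdR_eq
    linear_combination (c + 1) * q * (1 - X) * (1 + X) * F * fdR_eq - 2 * t * q * (1 - X) * F * hRR
      + 2 * (c + 3) * q * (1 + X) ^ 2 * F * hS' - X * hF' + (c + 3) * q * (1 + X) ^ 3 * F * h4
      + X * ((c + 1) * X * (1 + X) + 2 * t * (1 - X) + (1 + X) ^ 2) * F * h4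
  have hk := congrArg (coeff M) key
  have hXd : coeff M (X * d⁄dX ℝ F) = (M : ℝ) * coeff M F := by
    rcases M with _ | M
    · simp
    · rw [PowerSeries.coeff_succ_X_mul, PowerSeries.coeff_derivative]; push_cast; ring
  simp only [map_add, map_sub, PowerSeries.coeff_C_mul] at hk
  rw [hXd] at hk
  have b1 : Q * fdR * fdG r = fdR * F := by rw [hF]; ring
  have b2 : Q * fdR * fdR * fdG r = fdR * fdR * F := by rw [hF]; ring
  have b3 : Q * S * fdG r = S * F := by rw [hF]; ring
  simp only [b1, b2, b3, ← hF]
  push_cast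
  field_simp
  linear_combination 16 * hk
end

section
/- For every integer d ≥ 1, integer M ≥ 0 and every nonnegative integer k, the normalised radial moment admits the closed form m_{2k}^{N_0,d} = (1/N_0) · (Γ(d/2 + k)/Γ(d/2)) · Σ_{l=0}^k C(k, k-l) C(M+d, d+l) 2^l, where N_0 = C(M+d, d). -/
open MeasureTheory Real

section AuxAnalysis
open Polynomial

noncomputable def auxL (P : ℝ[X]) : ℝ := ∫ x : ℝ, P.eval x * Real.exp (-x ^ 2)

lemma aux_integrable (P : ℝ[X]) : Integrable (fun x : ℝ => P.eval x * Real.exp (-x ^ 2)) := by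
  induction P using Polynomial.induction_on' with
  | add p q hp hq => 
    have h := hp.add hq
    refine h.congr (Filter.Eventually.of_forall fun x => ?_)
    simp [add_mul]
  | monomial n a =>
    have h := (integrable_rpow_mul_exp_neg_mul_sq (b := 1) one_pos (s := (n : ℝ))
      (by have : (0 : ℝ) ≤ n := Nat.cast_nonneg n
          linarith)).const_mul a
    simpa [mul_assoc] using h

lemma auxL_add (P Q : ℝ[X]) : auxL (P + Q) = auxL P + auxL Q := by
  unfold auxL
  rw [← integral_add (aux_integrable P) (aux_integrable Q)]
  simp [add_mul]

lemma auxL_C_mul (c : ℝ) (P : ℝ[X]) : auxL (C c * P) = c * auxL P := by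
  unfold auxL
  rw [← integral_const_mul]
  simp [mul_assoc]

lemma auxL_ibp (P : ℝ[X]) : auxL (derivative P - 2 * X * P) = 0 := by
  unfold auxL
  apply integral_eq_zero_of_hasDerivAt_of_integrable (f := fun x => P.eval x * Real.exp (-x ^ 2))
    _ (aux_integrable _) (aux_integrable _)
  intro x
  have h1 := P.hasDerivAt x
  have h2 : HasDerivAt (fun x : ℝ => Real.exp (-x ^ 2)) (Real.exp (-x ^ 2) * (-(2 * x))) x := by
    have := ((hasDerivAt_pow 2 x).neg).exp
    simpa using this
  have h3 := h1.mul h2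
  refine h3.congr_deriv ?_
  simp
  ring

noncomputable def auxH : ℕ → ℝ[X]
  | 0 => 1
  | n + 1 => 2 * X * auxH n - derivative (auxH n)

lemma auxH_deriv (n : ℕ) : derivative (auxH (n + 1)) = C (2 * ((n : ℝ) + 1)) * auxH n := by
  induction n with
  | zero =>
    simp only [auxH]
    simp [map_ofNat]
  | succ n ih =>
    rw [auxH, derivative_sub, derivative_mul, ih]
    simp only [derivative_mul, derivative_C, derivative_X, derivative_ofNat]
    have : auxH (n + 1) = 2 * X * auxH n - derivative (auxH n) := rfl
    push_cast
    simp only [C_add, C_mul, map_ofNat, C_1] at *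
    linear_combination (-2 * (C (n : ℝ) + 1)) * this

lemma auxH_ode (n : ℕ) : derivative (derivative (auxH n)) =
    2 * X * derivative (auxH n) - C (2 * (n : ℝ)) * auxH n := by
  cases n with
  | zero => simp [auxH]
  | succ n =>
    rw [auxH_deriv, derivative_C_mul]
    have : auxH (n + 1) = 2 * X * auxH n - derivative (auxH n) := rfl
    push_cast
    simp only [C_add, C_mul, map_ofNat, C_1] at *
    linear_combination (2 * (C (n : ℝ) + 1)) * this

lemma auxH_eval (n : ℕ) (x : ℝ) : hermiteH n x = (auxH n).eval x := by
  induction n using Nat.strong_induction_on with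
  | _ n ih =>
    match n with
    | 0 => simp [auxH, hermiteH]
    | 1 => simp [auxH, hermiteH]
    | n + 2 =>
      simp only [hermiteH]
      rw [ih _ (by omega), ih _ (by omega), show auxH (n + 2) = 2 * X * auxH (n + 1) - derivative (auxH (n + 1)) from rfl,
        auxH_deriv]
      simp

lemma auxL_norm (n : ℕ) : auxL (auxH n ^ 2) = 2 ^ n * (Nat.factorial n) * Real.sqrt π := by
  induction n with
  | zero =>
    have := integral_gaussian 1
    simpa [auxL, auxH] using this
  | succ n ih =>
    have h := auxL_ibp (auxH n * auxH (n + 1))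
    have e : derivative (auxH n * auxH (n + 1)) - 2 * X * (auxH n * auxH (n + 1)) =
        C (-1) * auxH (n + 1) ^ 2 + C (2 * ((n : ℝ) + 1)) * auxH n ^ 2 := by
      rw [derivative_mul, auxH_deriv]
      have : auxH (n + 1) = 2 * X * auxH n - derivative (auxH n) := rfl
      simp only [C_neg, C_1]
      linear_combination (auxH (n + 1)) * this
    rw [e, auxL_add, auxL_C_mul, auxL_C_mul, ih] at h
    rw [Nat.factorial_succ]
    push_cast
    linear_combination -h

lemma auxL_rec (n : ℕ) (q : ℝ[X]) :
    auxL (derivative (derivative (derivative q)) * auxH n ^ 2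
      - 4 * derivative q * (X ^ 2 - C (2 * (n : ℝ) + 1)) * auxH n ^ 2
      - 4 * q * X * auxH n ^ 2) = 0 := by
  set H := auxH n with hH
  have hode := auxH_ode n
  rw [← hH] at hode
  set r1 := 2 * H * derivative H - 2 * X * H ^ 2 with hr1
  have h := auxL_ibp (q * (derivative r1 - 2 * X * r1) - derivative q * r1
    + derivative (derivative q) * H ^ 2 - 4 * q * (X ^ 2 - C (2 * (n : ℝ) + 1)) * H ^ 2)
  rw [← h]
  congr 1
  rw [hr1]
  simp only [derivative_sub, derivative_add, derivative_mul, derivative_pow, derivative_X,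
    derivative_C, derivative_ofNat, hode]
  simp only [C_add, C_mul, map_ofNat, C_1, derivative_one]
  simp [map_ofNat]
  ring

noncomputable def auxm (n p : ℕ) : ℝ := auxL (X ^ (2 * p) * auxH n ^ 2)

lemma auxm_rec0 (n : ℕ) : auxm n 1 = (2 * n + 1) / 2 * auxm n 0 := by
  have h := auxL_rec n X
  have e : (derivative (derivative (derivative (X : ℝ[X]))) * auxH n ^ 2
      - 4 * derivative X * (X ^ 2 - C (2 * (n : ℝ) + 1)) * auxH n ^ 2
      - 4 * X * X * auxH n ^ 2) = C (-8) * (X ^ (2 * 1) * auxH n ^ 2) +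
        C (4 * (2 * (n : ℝ) + 1)) * (X ^ (2 * 0) * auxH n ^ 2) := by
    simp [map_ofNat]
    ring
  rw [e, auxL_add, auxL_C_mul, auxL_C_mul] at h
  unfold auxm
  linear_combination (-1 / 8) * h

lemma auxm_rec (n p : ℕ) : 8 * ((p : ℝ) + 2) * auxm n (p + 2) =
    4 * (2 * n + 1) * (2 * p + 3) * auxm n (p + 1)
    + (2 * p + 3) * (2 * p + 2) * (2 * p + 1) * auxm n p := by
  have h := auxL_rec n (X ^ (2 * p + 3))
  have e : (derivative (derivative (derivative (X ^ (2 * p + 3) : ℝ[X]))) * auxH n ^ 2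
      - 4 * derivative (X ^ (2 * p + 3)) * (X ^ 2 - C (2 * (n : ℝ) + 1)) * auxH n ^ 2
      - 4 * X ^ (2 * p + 3) * X * auxH n ^ 2) =
        C (-8 * ((p : ℝ) + 2)) * (X ^ (2 * (p + 2)) * auxH n ^ 2) +
        (C (4 * (2 * (n : ℝ) + 1) * (2 * p + 3)) * (X ^ (2 * (p + 1)) * auxH n ^ 2) +
        C ((2 * (p : ℝ) + 3) * (2 * p + 2) * (2 * p + 1)) * (X ^ (2 * p) * auxH n ^ 2)) := by
    simp [map_ofNat]
    ring
  rw [e, auxL_add, auxL_add, auxL_C_mul, auxL_C_mul, auxL_C_mul] at h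
  unfold auxm
  linear_combination (-1) * h

lemma psi_sq_s7 (l p : ℕ) (x : ℝ) : x ^ (2 * p) * ψho l x ^ 2 =
    (2 ^ l * (Nat.factorial l) * Real.sqrt π)⁻¹ *
      ((X ^ (2 * p) * auxH l ^ 2).eval x * Real.exp (-x ^ 2)) := by
  have h : Real.exp (-x ^ 2) = Real.exp (-x ^ 2 / 2) ^ 2 := by
    rw [← Real.exp_nat_mul]
    congr 1
    push_cast
    ring
  unfold ψho
  rw [mul_pow, mul_pow, inv_pow, Real.sq_sqrt (by positivity), auxH_eval, h]
  simp
  ring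

lemma psi_integrable (l p : ℕ) : Integrable (fun x : ℝ => x ^ (2 * p) * ψho l x ^ 2) := by
  simp_rw [psi_sq_s7]
  exact (aux_integrable _).const_mul _

lemma psi_integral (l p : ℕ) : ∫ x : ℝ, x ^ (2 * p) * ψho l x ^ 2 =
    (2 ^ l * (Nat.factorial l) * Real.sqrt π)⁻¹ * auxm l p := by
  simp_rw [psi_sq_s7]
  rw [integral_const_mul]
  rfl

end AuxAnalysis

section AuxSeries
open PowerSeries

noncomputable def auxG : PowerSeries ℝ := PowerSeries.mk 1

noncomputable def auxF (p : ℕ) : PowerSeries ℝ := (1 + X) ^ p * auxG ^ (p + 1)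

lemma auxG_mul : auxG * (1 - X) = 1 := mk_one_mul_one_sub_eq_one ℝ

lemma auxG_deriv : derivative ℝ auxG = auxG ^ 2 := by
  have h := congrArg (derivative ℝ) auxG_mul
  rw [Derivation.leibniz, map_sub, Derivation.map_one_eq_zero, derivative_X] at h
  simp only [smul_eq_mul] at h
  have h2 := auxG_mul
  linear_combination auxG * h - (derivative ℝ auxG) * h2

lemma auxF_rec (p : ℕ) : ((p : PowerSeries ℝ) + 2) * auxF (p + 2) =
    2 * X * derivative ℝ (auxF (p + 1)) + auxF (p + 1) + ((p : PowerSeries ℝ) + 1) * auxF p := by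
  unfold auxF
  have h := auxG_mul
  have e1 : auxG ^ (p + 1) = auxG ^ (p + 3) * (1 - X) ^ 2 := by
    linear_combination (-auxG ^ (p + 1)) * (auxG * (1 - X) + 1) * h
  have e2 : auxG ^ (p + 2) = auxG ^ (p + 3) * (1 - X) := by
    linear_combination (-auxG ^ (p + 2)) * h
  rw [Derivation.leibniz, Derivation.leibniz_pow, Derivation.leibniz_pow, map_add,
    Derivation.map_one_eq_zero, derivative_X, auxG_deriv]
  simp only [smul_eq_mul, nsmul_eq_mul, Nat.add_sub_cancel]
  push_cast
  linear_combination (-(p + 1) * (1 + X) ^ p) * e1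
    - (2 * X * (p + 1) * (1 + X) ^ p + (1 + X) ^ (p + 1)) * e2

lemma auxD_zero (l : ℕ) : coeff l (auxF 0) = 1 := by
  simp [auxF, auxG]

lemma auxD_one (l : ℕ) : coeff l (auxF 1) = 2 * l + 1 := by
  have : auxF 1 = 2 * X * derivative ℝ auxG + auxG := by
    rw [auxG_deriv]
    have h := auxG_mul
    unfold auxF
    linear_combination auxG * h
  rw [this]
  cases l <;> simp [auxG, mul_assoc, ← map_ofNat (C (R := ℝ)), coeff_C_mul, coeff_succ_X_mul, coeff_derivative]

lemma auxD_rec (l p : ℕ) : ((p : ℝ) + 2) * coeff l (auxF (p + 2)) =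
    (2 * l + 1) * coeff l (auxF (p + 1)) + (p + 1) * coeff l (auxF p) := by
  have h := congrArg (coeff l) (auxF_rec p)
  have c1 : ((p : PowerSeries ℝ) + 2) = C ((p : ℝ) + 2) := by simp [map_ofNat]
  have c2 : ((p : PowerSeries ℝ) + 1) = C ((p : ℝ) + 1) := by simp
  have c3 : (2 : PowerSeries ℝ) = C 2 := by rw [map_ofNat]
  rw [c1, c2, mul_assoc 2 X, c3, map_add (coeff l), map_add (coeff l), coeff_C_mul, coeff_C_mul, coeff_C_mul] at h
  rw [h]
  cases l with
  | zero => simp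
  | succ l => 
    rw [coeff_succ_X_mul, coeff_derivative]
    push_cast
    ring

noncomputable def auxP (a : ℝ) (n : ℕ) : ℝ := (ascPochhammer ℝ n).eval a

lemma auxP_succ (a : ℝ) (n : ℕ) : auxP a (n + 1) = auxP a n * (a + n) := by
  simp [auxP, ascPochhammer_succ_eval]

lemma auxP_gamma (a : ℝ) (ha : 0 < a) (n : ℕ) :
    Real.Gamma (a + n) / Real.Gamma a = auxP a n := by
  have h0 := (Real.Gamma_pos_of_pos ha).ne'
  induction n with
  | zero => simp [auxP, h0]
  | succ n ih =>
    rw [auxP_succ, ← ih]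
    push_cast
    rw [← add_assoc, Real.Gamma_add_one (by positivity)]
    ring

noncomputable def auxV (a : ℝ) : PowerSeries ℝ := PowerSeries.mk fun n => auxP a n / (Nat.factorial n)

lemma auxV_eq (a : ℝ) : auxV a = rescale (-1 : ℝ) (binomialSeries ℝ (-a)) := by
  ext n
  have h := Ring.factorial_nsmul_multichoose_eq_ascPochhammer a n
  rw [Polynomial.ascPochhammer_smeval_eq_eval] at h
  rw [coeff_rescale, binomialSeries_coeff, Ring.choose_neg', auxV, coeff_mk, auxP, ← h]
  have : (Nat.factorial n : ℝ) ≠ 0 := by positivity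
  rcases Nat.even_or_odd n with hn | hn
  · rw [Int.negOnePow_even _ (by exact_mod_cast hn), hn.neg_one_pow]
    simp
    field_simp
  · rw [Int.negOnePow_odd _ (by exact_mod_cast hn), hn.neg_one_pow]
    simp
    field_simp

lemma auxV_pow (d : ℕ) : auxV (1 / 2) ^ d = auxV (d / 2) := by
  induction d with
  | zero => simp [auxV_eq]
  | succ d ih =>
    rw [pow_succ, ih, auxV_eq, auxV_eq, auxV_eq, ← map_mul, ← binomialSeries_add]
    congr 2
    push_cast
    ring

lemma aux_coeff_prod {d : ℕ} (f : Fin d → PowerSeries ℝ) (n : ℕ) :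
    coeff n (∏ j, f j) = ∑ l ∈ Finset.piAntidiag Finset.univ n, ∏ i, coeff (l i) (f i) := by
  rw [coeff_prod]
  refine Finset.sum_bij (fun l _ => (l : Fin d → ℕ)) ?_ ?_ ?_ ?_
  · intro l hl
    simpa using hl
  · intro a _ b _ h
    exact DFunLike.coe_injective h
  · intro b hb
    refine ⟨Finsupp.equivFunOnFinite.symm b, ?_, ?_⟩
    · simpa using hb
    · simp
  · intros
    rfl

lemma aux_vander (d k : ℕ) : ∑ p ∈ Finset.piAntidiag (Finset.univ : Finset (Fin d)) k,
    (Nat.multinomial Finset.univ p : ℝ) * ∏ i, auxP (1 / 2) (p i) = auxP (d / 2) k := by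
  have h := congrArg (coeff k) (auxV_pow d)
  have h2 := aux_coeff_prod (fun _ : Fin d => auxV (1 / 2)) k
  rw [Finset.prod_const, Finset.card_univ, Fintype.card_fin, h] at h2
  simp only [auxV, coeff_mk] at h2
  have hk : (Nat.factorial k : ℝ) ≠ 0 := by positivity
  rw [div_eq_iff hk, Finset.sum_mul] at h2
  rw [h2]
  refine Finset.sum_congr rfl fun p hp => ?_
  rw [Finset.mem_piAntidiag] at hp
  have hs := Nat.multinomial_spec Finset.univ p
  rw [hp.1] at hs
  rw [← hs, Finset.prod_div_distrib]
  push_cast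
  have : (∏ i, (Nat.factorial (p i) : ℝ)) ≠ 0 := by positivity
  field_simp

lemma aux_prodF {d : ℕ} (k : ℕ) (p : Fin d → ℕ) (hp : ∑ i, p i = k) :
    ∏ i, auxF (p i) = (1 + X) ^ k * auxG ^ (k + d) := by
  simp only [auxF]
  rw [Finset.prod_mul_distrib, Finset.prod_pow_eq_pow_sum, Finset.prod_pow_eq_pow_sum,
    Finset.sum_add_distrib, hp]
  simp

lemma aux_sum_filter {d : ℕ} (M : ℕ) (g : (Fin d → ℕ) → ℝ) :
    ∑ l ∈ Finset.filter (fun l => ∑ j, l j ≤ M)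
      (Fintype.piFinset fun _ : Fin d => Finset.range (M + 1)), g l =
    ∑ m ∈ Finset.range (M + 1), ∑ l ∈ Finset.piAntidiag Finset.univ m, g l := by
  symm
  rw [← Finset.sum_fiberwise_of_maps_to (g := fun l : Fin d → ℕ => ∑ j, l j)
    (t := Finset.range (M + 1))]
  · refine Finset.sum_congr rfl fun m hm => Finset.sum_congr ?_ fun _ _ => rfl
    ext l
    simp only [Finset.mem_piAntidiag, Finset.mem_filter, Fintype.mem_piFinset, Finset.mem_range] at *
    constructor
    · rintro ⟨h, -⟩
      change ∑ j, l j = m at h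
      refine ⟨⟨fun a => ?_, by omega⟩, h⟩
      have := Finset.single_le_sum (f := l) (fun _ _ => Nat.zero_le _) (Finset.mem_univ a)
      omega
    · rintro ⟨-, h⟩
      exact ⟨h, by simp⟩
  · intro l hl
    simp only [Finset.mem_filter, Finset.mem_range] at *
    omega

lemma aux_sum_coeff (f : PowerSeries ℝ) (M : ℕ) :
    ∑ m ∈ Finset.range (M + 1), coeff m f = coeff M (f * auxG) := by
  rw [coeff_mul, Finset.Nat.sum_antidiagonal_eq_sum_range_succ_mk]
  simp [auxG]

lemma aux_final (d M k : ℕ) : coeff M ((1 + X) ^ k * auxG ^ (k + d + 1)) =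
    ∑ l ∈ Finset.range (k + 1),
      (Nat.choose k (k - l) : ℝ) * (Nat.choose (M + d) (d + l) : ℝ) * 2 ^ l := by
  have h1 : (1 + X : PowerSeries ℝ) = C 2 * X + (1 - X) := by
    rw [map_ofNat]
    ring
  rw [h1, add_pow, Finset.sum_mul, map_sum]
  refine Finset.sum_congr rfl fun l hl => ?_
  have hl' : l ≤ k := by simpa [Nat.lt_succ_iff] using hl
  have e : (C 2 * X) ^ l * (1 - X) ^ (k - l) * (Nat.choose k l : PowerSeries ℝ)
      * auxG ^ (k + d + 1) = C (Nat.choose k l * 2 ^ l : ℝ) * (auxG ^ (d + l + 1) * X ^ l) := by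
    have : auxG ^ (k + d + 1) = auxG ^ (k - l) * auxG ^ (d + l + 1) := by
      rw [← pow_add]
      congr 1
      omega
    have h3 : auxG ^ (k - l) * (1 - X) ^ (k - l) = 1 := by
      rw [← mul_pow, auxG_mul, one_pow]
    rw [this, map_mul, map_natCast, map_pow]
    linear_combination ((C 2 * X) ^ l * (Nat.choose k l : PowerSeries ℝ) * auxG ^ (d + l + 1)) * h3
  rw [e, coeff_C_mul, coeff_mul_X_pow', auxG, mk_one_pow_eq_mk_choose_add, Nat.choose_symm hl']
  split_ifs with h
  · rw [coeff_mk, show d + l + (M - l) = M + d by omega]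
    ring
  · rw [Nat.choose_eq_zero_of_lt (show M + d < d + l by omega)]
    simp

end AuxSeries

section AuxMain
open PowerSeries

lemma psi_moment (l p : ℕ) : ∫ x : ℝ, x ^ (2 * p) * ψho l x ^ 2 =
    auxP (1 / 2) p * coeff l (auxF p) := by
  rw [psi_integral]
  have hN : (2 ^ l * (Nat.factorial l) * Real.sqrt π : ℝ) ≠ 0 := by positivity
  set N : ℝ := 2 ^ l * (Nat.factorial l) * Real.sqrt π with hNdef
  have h0 : auxm l 0 = N := by
    rw [hNdef, ← auxL_norm, auxm]
    simp
  rw [inv_mul_eq_div, div_eq_iff hN]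
  have key : ∀ p, auxm l p = auxP (1 / 2) p * coeff l (auxF p) * N ∧
      auxm l (p + 1) = auxP (1 / 2) (p + 1) * coeff l (auxF (p + 1)) * N := by
    intro p
    induction p with
    | zero =>
      constructor
      · rw [h0, auxD_zero]
        simp [auxP]
      · rw [zero_add, auxm_rec0, h0, auxD_one]
        rw [auxP, ascPochhammer_one, Polynomial.eval_X]
        ring
    | succ p ih =>
      refine ⟨ih.2, ?_⟩
      have h1 := auxm_rec l p
      have h2 := auxD_rec l p
      rw [ih.1, ih.2] at h1
      have hp : 8 * ((p : ℝ) + 2) ≠ 0 := by positivity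
      apply mul_left_cancel₀ hp
      change 8 * ((p : ℝ) + 2) * auxm l (p + 2) = 8 * ((p : ℝ) + 2) *
        (auxP (1 / 2) (p + 2) * coeff l (auxF (p + 2)) * N)
      rw [h1, show p + 2 = p + 1 + 1 from rfl, auxP_succ _ (p + 1), auxP_succ]
      push_cast
      linear_combination (-8 * auxP (1 / 2) p * (1 / 2 + p) * (1 / 2 + (p + 1)) * N) * h2
  exact (key p).1

lemma aux_main (d M k : ℕ) :
    ∫ x : EuclideanSpace ℝ (Fin d), ‖x‖ ^ (2 * k) * fermiDensity d M x =
      auxP (d / 2) k * coeff M ((1 + X) ^ k * auxG ^ (k + d + 1)) := by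
  rw [← (PiLp.volume_preserving_toLp (Fin d)).integral_comp
    (MeasurableEquiv.toLp 2 _).measurableEmbedding]
  have e : ∀ x : Fin d → ℝ, ‖WithLp.toLp 2 x‖ ^ (2 * k) * fermiDensity d M (WithLp.toLp 2 x) =
      ∑ l ∈ Finset.filter (fun l => ∑ j, l j ≤ M)
        (Fintype.piFinset fun _ : Fin d => Finset.range (M + 1)),
      ∑ p ∈ Finset.piAntidiag Finset.univ k, (Nat.multinomial Finset.univ p : ℝ) *
        ∏ j, (x j ^ (2 * p j) * ψho (l j) (x j) ^ 2) := by
    intro x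
    rw [pow_mul, EuclideanSpace.real_norm_sq_eq, Finset.sum_pow_eq_sum_piAntidiag, fermiDensity,
      Finset.mul_sum]
    refine Finset.sum_congr rfl fun l _ => ?_
    rw [Finset.sum_mul]
    refine Finset.sum_congr rfl fun p _ => ?_
    rw [Finset.prod_mul_distrib, mul_assoc]
    simp only [pow_mul]
  simp_rw [e]
  have hint : ∀ l p : Fin d → ℕ, Integrable (fun x : Fin d → ℝ =>
      (Nat.multinomial Finset.univ p : ℝ) *
        ∏ j, (x j ^ (2 * p j) * ψho (l j) (x j) ^ 2)) := fun l p =>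
    (Integrable.fintype_prod (f := fun j (y : ℝ) => y ^ (2 * p j) * ψho (l j) y ^ 2)
      (fun j => psi_integrable (l j) (p j))).const_mul _
  rw [integral_finsetSum _ fun l _ => integrable_finsetSum _ fun p _ => hint l p]
  simp_rw [fun l : Fin d → ℕ => integral_finsetSum (Finset.piAntidiag Finset.univ k)
    fun p _ => hint l p, integral_const_mul]
  have hprod : ∀ l p : Fin d → ℕ, ∫ x : Fin d → ℝ, ∏ j, (x j ^ (2 * p j) * ψho (l j) (x j) ^ 2) =
      (∏ j, auxP (1 / 2) (p j)) * ∏ j, coeff (l j) (auxF (p j)) := by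
    intro l p
    rw [integral_fintype_prod_volume_eq_prod (fun j (y : ℝ) => y ^ (2 * p j) * ψho (l j) y ^ 2),
      ← Finset.prod_mul_distrib]
    exact Finset.prod_congr rfl fun j _ => psi_moment _ _
  simp_rw [hprod]
  rw [Finset.sum_comm, ← aux_vander, Finset.sum_mul]
  refine Finset.sum_congr rfl fun p hp => ?_
  rw [Finset.mem_piAntidiag] at hp
  simp_rw [← mul_assoc]
  rw [← Finset.mul_sum, aux_sum_filter]
  simp_rw [← aux_coeff_prod (fun j => auxF (p j))]
  rw [aux_sum_coeff, aux_prodF k p hp.1, mul_assoc (_ ^ k), ← pow_succ]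

end AuxMain

/-- closed form for the normalised `2k`-th radial moment:
`m_{2k} = (1/N₀)(Γ(d/2+k)/Γ(d/2)) Σ_{l=0}^k C(k,k-l) C(M+d,d+l) 2^l`, `N₀ = C(M+d,d)`. -/
theorem fermi_moment_closed_form (d M k : ℕ) (hd : 1 ≤ d) :
    (1 / (Nat.choose (M + d) d : ℝ)) *
        ∫ x : EuclideanSpace ℝ (Fin d), ‖x‖ ^ (2 * k) * fermiDensity d M x =
      (1 / (Nat.choose (M + d) d : ℝ)) *
        (Real.Gamma ((d : ℝ) / 2 + k) / Real.Gamma ((d : ℝ) / 2)) *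
          ∑ l ∈ Finset.range (k + 1),
            (Nat.choose k (k - l) : ℝ) * (Nat.choose (M + d) (d + l) : ℝ) * 2 ^ l := by
  rw [mul_assoc, aux_main, auxP_gamma _ (by positivity), aux_final]
end

section
/- For every integer d ≥ 1 and integer M ≥ 0, the normalised radial moments satisfy m_0^{N_0,d} = 1 and, for every integer k ≥ 0, the second order recurrence (2(k+d+1)/(2k+d)) m_{2k+2}^{N_0,d} = (2M + d + 1) m_{2k}^{N_0,d} + k (k + d/2 - 1) m_{2k-2}^{N_0,d} (the last term being interpreted as 0 when k = 0). -/
open MeasureTheory Real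

open Polynomial in
noncomputable def hp : ℕ → ℝ[X]
  | 0 => 1
  | 1 => 2 * X
  | (n + 2) => 2 * X * hp (n + 1) - 2 * ((n : ℝ[X]) + 1) * hp n

section oneD
open Polynomial

lemma hp_eval : ∀ (n : ℕ) (x : ℝ), (hp n).eval x = hermiteH n x
  | 0, x => by simp [hp, hermiteH]
  | 1, x => by simp [hp, hermiteH]
  | (n + 2), x => by simp [hp, hermiteH, hp_eval (n+1) x, hp_eval n x]

lemma hp_deriv : ∀ n : ℕ, derivative (hp (n+1)) = 2 * ((n : ℝ[X]) + 1) * hp n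
  | 0 => by simp [hp]
  | 1 => by simp [hp]; ring
  | (n + 2) => by
    have h1 := hp_deriv (n+1)
    have h0 := hp_deriv n
    rw [hp]
    simp only [derivative_sub, derivative_mul, derivative_X, h1, h0, derivative_ofNat, derivative_add, derivative_natCast, derivative_one]
    rw [show hp (n+2) = 2 * X * hp (n + 1) - 2 * ((n : ℝ[X]) + 1) * hp n by rw [hp]]
    push_cast
    ring

lemma hp_succ (n : ℕ) : hp (n+1) = 2 * X * hp n - derivative (hp n) := by
  cases n with
  | zero => simp [hp]
  | succ n => rw [hp_deriv, hp]

lemma hp_deriv2 (n : ℕ) : derivative (derivative (hp n)) =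
    2 * X * derivative (hp n) - 2 * (n : ℝ[X]) * hp n := by
  have h := hp_deriv n
  rw [hp_succ] at h
  simp only [derivative_sub, derivative_mul, derivative_X, derivative_ofNat] at h
  linear_combination -h

lemma int_poly (p : ℝ[X]) : Integrable (fun x : ℝ => p.eval x * Real.exp (-x^2)) := by
  induction p using Polynomial.induction_on' with
  | add p q hp hq => simp only [eval_add, add_mul]; exact hp.add hq
  | monomial n a =>
    have h := integrable_rpow_mul_exp_neg_mul_sq (b := 1) one_pos (s := n) (by have : (0:ℝ) ≤ n := by positivity
                                                                               linarith)
    simp only [rpow_natCast] at h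
    simpa [mul_assoc] using h.const_mul a

noncomputable def Lf : ℝ[X] →ₗ[ℝ] ℝ where
  toFun p := ∫ x : ℝ, p.eval x * Real.exp (-x^2)
  map_add' p q := by
    simp only [eval_add, add_mul]
    exact integral_add (int_poly p) (int_poly q)
  map_smul' c p := by
    simp only [eval_smul, smul_eq_mul, mul_assoc, RingHom.id_apply]
    exact integral_const_mul _ _

noncomputable def Dd (p : ℝ[X]) : ℝ[X] := derivative p - 2 * X * p

lemma Lf_D (p : ℝ[X]) : Lf (Dd p) = 0 := by
  have := integral_eq_zero_of_hasDerivAt_of_integrable (f := fun x : ℝ => p.eval x * Real.exp (-x^2))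
    (f' := fun x : ℝ => (Dd p).eval x * Real.exp (-x^2)) (fun x => by
      have h1 := p.hasDerivAt x
      have h2 : HasDerivAt (fun x : ℝ => Real.exp (-x^2)) (Real.exp (-x^2) * (-(2 * x))) x := by
        simpa using ((hasDerivAt_pow 2 x).neg).exp
      refine (h1.mul h2).congr_deriv ?_
      simp [Dd]; ring) (int_poly _) (int_poly _)
  exact this

lemma Lf_ibp (p q : ℝ[X]) : Lf (p * Dd q) = - Lf (derivative p * q) := by
  have h := Lf_D (p * q)
  have : Dd (p * q) = p * Dd q + derivative p * q := by simp [Dd]; ring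
  rw [this, map_add] at h
  linarith

lemma Lf_C (c : ℝ) (p : ℝ[X]) : Lf (C c * p) = c * Lf p := by
  rw [← smul_eq_C_mul, map_smul, smul_eq_mul]

lemma Lf_sq (n : ℕ) : Lf (hp n ^ 2) = 2 ^ n * n.factorial * √π := by
  induction n with
  | zero =>
    have := integral_gaussian 1
    simp [Lf, hp] at this ⊢
    exact this
  | succ n ih =>
    have h : hp (n+1) ^ 2 = - (hp (n+1) * Dd (hp n)) := by
      rw [sq]; nth_rewrite 2 [hp_succ]; simp [Dd]; ring
    rw [h, map_neg, Lf_ibp, hp_deriv]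
    have : 2 * ((n : ℝ[X]) + 1) * hp n * hp n = C (2 * ((n : ℝ) + 1)) * hp n ^ 2 := by
      simp [map_ofNat C]; ring
    rw [this, neg_neg, Lf_C, ih, Nat.factorial_succ]
    push_cast; ring

lemma Dd3 (n : ℕ) : Dd (Dd (Dd (hp n ^ 2))) =
    4 * (X ^ 2 - (2 * (n : ℝ[X]) + 1)) * Dd (hp n ^ 2) + 4 * X * hp n ^ 2 := by
  have h2 := hp_deriv2 n
  set h := hp n
  set h1 := derivative h with hh1
  have e1 : Dd (h ^ 2) = 2 * h * h1 - 2 * X * h ^ 2 := by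
    simp only [Dd, sq, derivative_mul]; ring
  have e2 : Dd (Dd (h ^ 2)) = 2 * h1 ^ 2 - 4 * (n:ℝ[X]) * h ^ 2 - 2 * h ^ 2 - 8 * X * h * h1 + 8 * X ^ 2 * h ^ 2 + 4 * X * h * h1 - 4 * X ^ 2 * h ^ 2 := by
    rw [e1]
    simp only [Dd, sq, derivative_mul, derivative_sub, derivative_ofNat, derivative_X, h2, ← hh1]; ring
  rw [e2, e1]
  simp only [Dd, sq, derivative_mul, derivative_sub, derivative_add, derivative_natCast, derivative_ofNat, derivative_X, h2, ← hh1]; ring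

lemma Lf_rec (n a : ℕ) : 2 * ((a:ℝ) + 1) * Lf (X ^ (2 * (a+1)) * hp n ^ 2) =
    (2 * n + 1) * (2 * a + 1) * Lf (X ^ (2 * a) * hp n ^ 2) +
    (2 * a + 1) * a * (2 * a - 1) / 2 * Lf (X ^ (2 * (a - 1)) * hp n ^ 2) := by
  have h := congrArg (fun p => Lf (X ^ (2 * a + 1) * p)) (Dd3 n)
  set q := hp n ^ 2
  rw [Lf_ibp, Lf_ibp, Lf_ibp] at h
  have e1 : derivative (derivative (derivative (X ^ (2 * a + 1) : ℝ[X]))) =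
      C ((2 * a + 1) * (2 * a) * (2 * a - 1) : ℝ) * X ^ (2 * (a - 1)) := by
    rcases a with _ | a
    · simp
    · simp [map_ofNat C, show 2 * (a + 1) = 2 * a + 1 + 1 by ring]; ring
  have e2 : X ^ (2 * a + 1) * (4 * (X ^ 2 - (2 * (n : ℝ[X]) + 1)) * Dd q + 4 * X * q) =
    (C 4 * (X ^ (2 * a + 3)) - C (4 * (2 * (n:ℝ) + 1)) * X ^ (2 * a + 1)) * Dd q + C 4 * (X ^ (2 * (a + 1)) * q) := by
    simp [map_ofNat C]; ring
  have e3 : derivative (C 4 * (X ^ (2 * a + 3)) - C (4 * (2 * (n:ℝ) + 1)) * X ^ (2 * a + 1)) * q =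
     C (4 * (2 * (a:ℝ) + 3)) * (X ^ (2 * (a + 1)) * q) - C (4 * (2 * (n:ℝ) + 1) * (2 * a + 1)) * (X ^ (2 * a) * q) := by
    simp only [derivative_sub, derivative_C_mul, derivative_X_pow]
    simp [map_ofNat C]; ring
  rw [e1, e2, map_add, Lf_ibp, e3, map_sub, Lf_C, Lf_C, Lf_C, mul_assoc, Lf_C] at h
  linarith

noncomputable def Im (a n : ℕ) : ℝ := ∫ x : ℝ, x ^ (2 * a) * ψho n x ^ 2

lemma integrand_eq (a n : ℕ) (x : ℝ) : x ^ (2 * a) * ψho n x ^ 2 =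
    (2 ^ n * n.factorial * √π)⁻¹ * ((X ^ (2 * a) * hp n ^ 2 : ℝ[X]).eval x * Real.exp (-x^2)) := by
  have : Real.exp (-x^2) = Real.exp (-x^2/2) ^ 2 := by
    rw [← Real.exp_nat_mul]; congr 1; push_cast; ring
  rw [this]
  simp only [ψho, mul_pow, inv_pow, eval_mul, eval_pow, eval_X, hp_eval]
  rw [Real.sq_sqrt (by positivity)]
  ring

lemma Im_int (a n : ℕ) : Integrable (fun x : ℝ => x ^ (2 * a) * ψho n x ^ 2) := by
  simp only [integrand_eq]
  exact (int_poly _).const_mul _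

lemma Im_eq (a n : ℕ) : Im a n = (2 ^ n * n.factorial * √π)⁻¹ * Lf (X ^ (2 * a) * hp n ^ 2) := by
  simp only [Im, integrand_eq]
  exact integral_const_mul _ _

lemma Im_zero (n : ℕ) : Im 0 n = 1 := by
  have : (0:ℝ) < √π := Real.sqrt_pos.2 Real.pi_pos
  rw [Im_eq]
  simp only [mul_zero, pow_zero, one_mul, Lf_sq]
  field_simp

lemma Im_rec (n a : ℕ) : 2 * ((a:ℝ) + 1) * Im (a+1) n =
    (2 * n + 1) * (2 * a + 1) * Im a n +
    (2 * a + 1) * a * (2 * a - 1) / 2 * Im (a - 1) n := by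
  simp only [Im_eq]
  linear_combination (2 ^ n * (n.factorial : ℝ) * √π)⁻¹ * Lf_rec n a

end oneD
section ps
open PowerSeries

noncomputable def ww : ℝ⟦X⟧ := PowerSeries.mk 1

lemma ww_mul : ww * (1 - X) = 1 := PowerSeries.mk_one_mul_one_sub_eq_one ℝ

lemma ww_deriv : d⁄dX ℝ ww = ww ^ 2 := by
  have h := congrArg (d⁄dX ℝ) ww_mul
  simp only [Derivation.leibniz, map_sub, PowerSeries.derivative_X, smul_eq_mul, PowerSeries.derivative_one] at h
  linear_combination ww * h - (d⁄dX ℝ ww) * ww_mul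

noncomputable def GG (e k : ℕ) : ℝ⟦X⟧ := (1 + X) ^ k * ww ^ (e + k)

lemma ww_pow_deriv (n : ℕ) : d⁄dX ℝ (ww ^ n) = (n : ℝ⟦X⟧) * ww ^ (n + 1) := by
  rw [PowerSeries.derivative_pow, ww_deriv]
  cases n <;> simp; ring

lemma GG_rec (e k : ℕ) : ((k : ℝ⟦X⟧) + (e : ℝ⟦X⟧)) * GG e (k+1) =
    2 * (d⁄dX ℝ (GG e k) * X) + (e : ℝ⟦X⟧) * GG e k + (k : ℝ⟦X⟧) * GG e (k - 1) := by
  have hw := ww_mul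
  rcases k with _ | k
  · simp only [GG, Derivation.leibniz, ww_pow_deriv, smul_eq_mul]
    simp only [PowerSeries.derivative_pow, map_add, PowerSeries.derivative_X, PowerSeries.derivative_one]
    simp
    linear_combination (e : ℝ⟦X⟧) * ww ^ e * hw
  · simp only [GG, Derivation.leibniz, ww_pow_deriv, smul_eq_mul]
    simp only [PowerSeries.derivative_pow, map_add, PowerSeries.derivative_X, PowerSeries.derivative_one]
    simp
    linear_combination (1 + X) ^ k * ww ^ (e + k) * ((k:ℝ⟦X⟧) + 1 + ((k:ℝ⟦X⟧) + 1 + (e : ℝ⟦X⟧)) * (1 + X) * ww) * hw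

lemma GG_coeff (e k n : ℕ) : ((k : ℝ) + e) * coeff n (GG e (k+1)) =
    (2 * n + e) * coeff n (GG e k) + k * coeff n (GG e (k - 1)) := by
  have h := congrArg (coeff n) (GG_rec e k)
  have hX : coeff n (d⁄dX ℝ (GG e k) * X) = n * coeff n (GG e k) := by
    cases n with
    | zero => simp
    | succ n => rw [coeff_succ_mul_X, coeff_derivative]; push_cast; ring
  have e1 : ((k : ℝ⟦X⟧) + (e : ℝ⟦X⟧)) = C ((k:ℝ) + e) := by simp
  have e2 : (e : ℝ⟦X⟧) = C (e : ℝ) := by simp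
  have e3 : (k : ℝ⟦X⟧) = C (k : ℝ) := by simp
  have e4 : (2 : ℝ⟦X⟧) = C (2 : ℝ) := (map_ofNat (C (R := ℝ)) 2).symm
  rw [e1, e2, e3, e4, (coeff n).map_add, (coeff n).map_add, coeff_C_mul, coeff_C_mul, coeff_C_mul, coeff_C_mul, hX] at h
  linarith

noncomputable def poch (s : ℝ) (k : ℕ) : ℝ := ∏ i ∈ Finset.range k, (s + i)

lemma poch_succ (s : ℝ) (k : ℕ) : poch s (k+1) = poch s k * (s + k) := by
  simp [poch, Finset.prod_range_succ]

lemma poch_zero (s : ℝ) : poch s 0 = 1 := by simp [poch]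

lemma ww_coeff (n : ℕ) : coeff n ww = 1 := by simp [ww]

lemma Im_closed (a n : ℕ) : Im a n = poch (1/2) a * coeff n (GG 1 a) := by
  induction a using Nat.strong_induction_on with
  | _ a ih =>
  rcases a with _ | a
  · simp [Im_zero, poch_zero, GG, ww_coeff]
  · have h := Im_rec n a
    have hG := GG_coeff 1 a n
    rw [ih a (by omega)] at h
    have h2 : (a:ℝ) * (2 * a - 1) / 2 * Im (a-1) n = a * (poch (1/2) a * coeff n (GG 1 (a-1))) := by
      rcases a with _ | a
      · simp
      · rw [ih _ (by omega), poch_succ]; simp; ring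
    rw [poch_succ]
    have : (a:ℝ) + 1 ≠ 0 := by positivity
    apply mul_left_cancel₀ this
    push_cast at hG
    linear_combination h/2 + (2 * (a:ℝ) + 1)/2 * h2 - poch (1/2) a * (1/2 + a) * hG

lemma coeff_prod_pi {d : ℕ} (f : Fin d → ℝ⟦X⟧) (n : ℕ) :
    coeff n (∏ j, f j) = ∑ l ∈ Finset.piAntidiag Finset.univ n, ∏ j, coeff (l j) (f j) := by
  rw [coeff_prod]
  refine Finset.sum_bij' (fun l _ => ⇑l) (fun l _ => Finsupp.equivFunOnFinite.symm l) ?_ ?_ ?_ ?_ ?_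
  · intro l hl; simpa using hl
  · intro l hl; simpa using hl
  · intro l hl; ext; simp
  · intro l hl; ext; simp
  · intro l hl; rfl

noncomputable def EE : ℝ⟦X⟧ := PowerSeries.mk fun a => poch (1/2) a / a.factorial

lemma EE_ode : d⁄dX ℝ EE * (1 - X) = C (1/2) * EE := by
  ext n
  rw [mul_sub, mul_one, map_sub, coeff_C_mul]
  rcases n with _ | n
  · simp [EE, coeff_derivative, poch]
  · rw [coeff_succ_mul_X]
    simp only [coeff_derivative, EE, coeff_mk, poch_succ, Nat.factorial_succ]
    push_cast
    field_simp
    ring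

lemma EE_pow_ode (d : ℕ) : d⁄dX ℝ (EE ^ d) * (1 - X) = C ((d:ℝ)/2) * EE ^ d := by
  have h := EE_ode
  have : C ((d:ℝ)/2) = (d : ℝ⟦X⟧) * C (1/2) := by
    rw [show (d:ℝ)/2 = d * (1/2) by ring, map_mul]; simp
  rw [PowerSeries.derivative_pow, this]
  rcases d with _ | d
  · simp
  · simp only [Nat.add_sub_cancel]
    linear_combination ((d+1:ℕ) : ℝ⟦X⟧) * EE ^ d * h

lemma EE_pow_coeff (d k : ℕ) : coeff k (EE ^ d) = poch ((d:ℝ)/2) k / k.factorial := by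
  induction k with
  | zero => simp [EE, poch]
  | succ k ih =>
    have h := congrArg (coeff k) (EE_pow_ode d)
    have h3 : coeff k (d⁄dX ℝ (EE ^ d) * X) = k * coeff k (EE ^ d) := by
      rcases k with _ | k
      · simp
      · rw [coeff_succ_mul_X, coeff_derivative]; push_cast; ring
    rw [mul_sub, mul_one, map_sub, coeff_C_mul, h3, coeff_derivative, ih] at h
    rw [poch_succ, Nat.factorial_succ]
    push_cast
    have : (k:ℝ) + 1 ≠ 0 := by positivity
    field_simp at h ⊢
    linarith

lemma multi_sum (d k : ℕ) : ∑ α ∈ Finset.piAntidiag (Finset.univ : Finset (Fin d)) k,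
    (Nat.multinomial Finset.univ α : ℝ) * ∏ j, poch (1/2) (α j) = poch ((d:ℝ)/2) k := by
  have h := coeff_prod_pi (fun _ : Fin d => EE) k
  rw [Finset.prod_const, Finset.card_univ, Fintype.card_fin, EE_pow_coeff] at h
  have hk : (k.factorial : ℝ) ≠ 0 := by positivity
  rw [div_eq_iff hk, Finset.sum_mul] at h
  rw [h]
  refine Finset.sum_congr rfl fun α hα => ?_
  have hs : ∑ j, α j = k := by simpa using hα
  have hm := Nat.multinomial_spec (Finset.univ : Finset (Fin d)) α
  rw [hs] at hm
  rw [← hm]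
  simp only [EE, coeff_mk, Finset.prod_div_distrib]
  push_cast
  have : (∏ j, ((α j).factorial : ℝ)) ≠ 0 := Finset.prod_ne_zero_iff.2 fun j _ => by positivity
  field_simp

lemma prod_Im {d k : ℕ} (M : ℕ) (α : Fin d → ℕ) (hs : ∑ j, α j = k) :
    ∑ l ∈ Finset.filter (fun l => ∑ j, l j ≤ M)
      (Fintype.piFinset fun _ : Fin d => Finset.range (M + 1)), ∏ j, Im (α j) (l j) =
    (∏ j, poch (1/2) (α j)) * coeff M (GG (d+1) k) := by
  have h1 : ∑ l ∈ Finset.filter (fun l => ∑ j, l j ≤ M)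
      (Fintype.piFinset fun _ : Fin d => Finset.range (M + 1)), ∏ j, Im (α j) (l j) =
      ∑ n ∈ Finset.range (M+1), ∑ l ∈ Finset.piAntidiag (Finset.univ : Finset (Fin d)) n,
        ∏ j, Im (α j) (l j) := by
    rw [← Finset.sum_fiberwise_of_maps_to (t := Finset.range (M+1)) (g := fun l => ∑ j, l j)]
    · refine Finset.sum_congr rfl fun n hn => ?_
      refine Finset.sum_congr ?_ fun _ _ => rfl
      ext l
      simp only [Finset.mem_filter, Fintype.mem_piFinset, Finset.mem_range, Finset.mem_piAntidiag] at hn ⊢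
      constructor
      · rintro ⟨_, h⟩; exact ⟨h, by simp⟩
      · rintro ⟨h, _⟩
        have h : ∑ j, l j = n := h
        refine ⟨⟨fun j => ?_, by omega⟩, h⟩
        have := Finset.single_le_sum (f := l) (fun i _ => Nat.zero_le _) (Finset.mem_univ j)
        omega
    · intro l hl
      simp only [Finset.mem_filter, Finset.mem_range] at hl ⊢
      omega
  have h2 : ∀ n, ∑ l ∈ Finset.piAntidiag (Finset.univ : Finset (Fin d)) n, ∏ j, Im (α j) (l j) =
      (∏ j, poch (1/2) (α j)) * coeff n (GG d k) := by
    intro n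
    have h3 : GG d k = ∏ j, GG 1 (α j) := by
      simp only [GG, Finset.prod_mul_distrib, Finset.prod_pow_eq_pow_sum, Finset.sum_add_distrib, hs]
      simp
    rw [h3, coeff_prod_pi, Finset.mul_sum]
    refine Finset.sum_congr rfl fun l _ => ?_
    simp only [Im_closed, Finset.prod_mul_distrib]
  rw [h1]
  simp only [h2]
  rw [← Finset.mul_sum]
  congr 1
  have h4 : GG (d+1) k = GG d k * ww := by simp only [GG]; ring
  rw [h4, coeff_mul, Finset.Nat.sum_antidiagonal_eq_sum_range_succ_mk]
  simp [ww_coeff]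

end ps

lemma fermi_int (d M k : ℕ) :
    ∫ x : EuclideanSpace ℝ (Fin d), ‖x‖ ^ (2 * k) * fermiDensity d M x =
    poch ((d:ℝ)/2) k * PowerSeries.coeff M (GG (d+1) k) := by
  rw [← (PiLp.volume_preserving_toLp (Fin d)).integral_comp
    (MeasurableEquiv.toLp 2 _).measurableEmbedding]
  have h : ∀ x : Fin d → ℝ, ‖WithLp.toLp 2 x‖ ^ (2 * k) * fermiDensity d M (WithLp.toLp 2 x) =
    ∑ α ∈ Finset.piAntidiag (Finset.univ : Finset (Fin d)) k,
    ∑ l ∈ Finset.filter (fun l => ∑ j, l j ≤ M)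
      (Fintype.piFinset fun _ : Fin d => Finset.range (M + 1)),
    (Nat.multinomial Finset.univ α : ℝ) * ∏ j, (x j ^ (2 * α j) * ψho (l j) (x j) ^ 2) := by
    intro x
    rw [pow_mul, EuclideanSpace.norm_sq_eq]
    simp only [Real.norm_eq_abs, sq_abs, fermiDensity]
    rw [Finset.sum_pow_eq_sum_piAntidiag, Finset.sum_mul_sum]
    refine Finset.sum_congr rfl fun α _ => Finset.sum_congr rfl fun l _ => ?_
    simp only [Finset.prod_mul_distrib, pow_mul, mul_assoc]
  simp only [h]
  have hi : ∀ (α l : Fin d → ℕ), Integrable (fun x : Fin d → ℝ =>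
      (Nat.multinomial Finset.univ α : ℝ) * ∏ j, (x j ^ (2 * α j) * ψho (l j) (x j) ^ 2)) := by
    intro α l
    exact (Integrable.fintype_prod (f := fun j (y : ℝ) => y ^ (2 * α j) * ψho (l j) y ^ 2)
      (fun j => Im_int _ _)).const_mul _
  rw [integral_finsetSum _ fun α _ => integrable_finsetSum _ fun l _ => hi α l]
  rw [← multi_sum, Finset.sum_mul]
  refine Finset.sum_congr rfl fun α hα => ?_
  rw [integral_finsetSum _ fun l _ => hi α l, mul_assoc, ← prod_Im M α (by simpa using hα), Finset.mul_sum]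
  refine Finset.sum_congr rfl fun l _ => ?_
  rw [integral_const_mul, integral_fintype_prod_volume_eq_prod (f := fun j (y : ℝ) => y ^ (2 * α j) * ψho (l j) y ^ 2)]
  rfl

/-- `m₀ = 1` and the second order recurrence
`(2(k+d+1)/(2k+d)) m_{2k+2} = (2M+d+1) m_{2k} + k(k+d/2-1) m_{2k-2}`
(the last term interpreted as `0` when `k = 0`, its coefficient `k` vanishing). -/
theorem fermi_moment_recurrence (d M : ℕ) (hd : 1 ≤ d)
    (m : ℕ → ℝ)
    (hm : ∀ k : ℕ, m k = (1 / (Nat.choose (M + d) d : ℝ)) *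
        ∫ x : EuclideanSpace ℝ (Fin d), ‖x‖ ^ (2 * k) * fermiDensity d M x) :
    m 0 = 1 ∧
      ∀ k : ℕ,
        (2 * ((k : ℝ) + (d : ℝ) + 1) / (2 * (k : ℝ) + (d : ℝ))) * m (k + 1) =
          (2 * (M : ℝ) + (d : ℝ) + 1) * m k +
            (k : ℝ) * ((k : ℝ) + (d : ℝ) / 2 - 1) * m (k - 1) := by
  have hN : ((M + d).choose d : ℝ) ≠ 0 := by
    have := Nat.choose_pos (show d ≤ M + d by omega)
    positivity
  have hm' : ∀ k, m k = (1 / (Nat.choose (M + d) d : ℝ)) *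
      (poch ((d:ℝ)/2) k * PowerSeries.coeff M (GG (d+1) k)) := fun k => by rw [hm, fermi_int]
  refine ⟨?_, fun k => ?_⟩
  · rw [hm', poch_zero]
    have : PowerSeries.coeff M (GG (d+1) 0) = ((M + d).choose d : ℝ) := by
      simp only [GG, ww, pow_zero, one_mul, add_zero]
      rw [PowerSeries.mk_one_pow_eq_mk_choose_add, PowerSeries.coeff_mk, add_comm]
    rw [this]
    field_simp
  · have hd' : (0:ℝ) < d := by exact_mod_cast hd
    have hG := GG_coeff (d+1) k M
    have h2 : (k:ℝ) * (k + (d:ℝ)/2 - 1) * m (k-1) =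
        k * ((1 / (Nat.choose (M + d) d : ℝ)) *
          (poch ((d:ℝ)/2) k * PowerSeries.coeff M (GG (d+1) (k-1)))) := by
      rw [hm']
      rcases k with _ | k
      · simp
      · rw [poch_succ]
        simp only [Nat.add_sub_cancel]
        push_cast
        ring
    rw [h2, hm' k, hm' (k+1), poch_succ]
    have h3 : 2 * ((k : ℝ) + (d : ℝ) + 1) / (2 * (k : ℝ) + (d : ℝ)) =
        ((k : ℝ) + (d : ℝ) + 1) / ((d:ℝ)/2 + k) := by
      field_simp
      ring
    have h4 : (d:ℝ)/2 + k ≠ 0 := by positivity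
    rw [h3, div_mul_eq_mul_div, div_eq_iff h4]
    push_cast at hG
    linear_combination (1 / (Nat.choose (M + d) d : ℝ)) * poch ((d:ℝ)/2) k * ((d:ℝ)/2 + k) * hG
end

section
/- Fix an integer d ≥ 1. Let μ^{(d)} : ℤ × ℤ → ℝ be the unique family satisfying μ^{(d)}_{0,0} = 1, μ^{(d)}_{k,l} = 0 whenever k < 0 or l < 0 or l > ⌊k/2⌋, and, for all integers k ≥ 0 and l, the recurrence (k+d+1) μ^{(d)}_{k+1,l} = k (k + d/2)(k + d/2 - 1) μ^{(d)}_{k-1,l-1} + (2k + d) μ^{(d)}_{k,l}. Then for every integer M ≥ 0 and every nonnegative integer k, with M̃ = M + (d+1)/2, the normalised radial moment admits the expansion m_{2k}^{N_0,d} = Σ_{l=0}^{⌊k/2⌋} M̃^{k-2l} μ^{(d)}_{k,l}; in particular the dependence of m_{2k}^{N_0,d} on M is through M̃ alone, and m_{2k}^{N_0,d} is an even (odd) polynomial in M̃ for k even (odd). -/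
open MeasureTheory Real

namespace HZ

open PowerSeries in
/-- geometric series -/
noncomputable def gs : PowerSeries ℝ := PowerSeries.mk 1

lemma gs_mul : gs * (1 - PowerSeries.X) = 1 := PowerSeries.mk_one_mul_one_sub_eq_one ℝ

lemma gs_deriv : PowerSeries.derivative ℝ gs = gs ^ 2 := by
  have h := congrArg (PowerSeries.derivative ℝ) gs_mul
  simp only [Derivation.leibniz, map_sub, PowerSeries.derivative_one, PowerSeries.derivative_X,
    smul_eq_mul] at h
  linear_combination gs * h - (PowerSeries.derivative ℝ gs) * gs_mul

/-- generating function -/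
noncomputable def fz (d k : ℕ) : PowerSeries ℝ := (1 + PowerSeries.X) ^ k * gs ^ (d + k + 1)

lemma fz_deriv (d k : ℕ) : ((k : PowerSeries ℝ) + (d : PowerSeries ℝ) + 1) * fz d (k + 1) =
    (k : PowerSeries ℝ) * fz d (k - 1) + 2 * (PowerSeries.X * PowerSeries.derivative ℝ (fz d k))
      + ((d : PowerSeries ℝ) + 1) * fz d k := by
  have hg := gs_mul
  rcases k with _ | k
  · simp only [fz, Derivation.leibniz, PowerSeries.derivative_pow, gs_deriv, smul_eq_mul, map_add,
      PowerSeries.derivative_one, PowerSeries.derivative_X]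
    push_cast
    simp only [add_zero, zero_add, pow_zero]
    linear_combination ((d : PowerSeries ℝ) + 1) * gs ^ (d + 1) * hg
  · simp only [fz, Derivation.leibniz, PowerSeries.derivative_pow, gs_deriv, smul_eq_mul, map_add,
      PowerSeries.derivative_one, PowerSeries.derivative_X]
    push_cast
    linear_combination (((k : PowerSeries ℝ) + (d : PowerSeries ℝ) + 2) * (1 + PowerSeries.X) ^ (k+1) * gs ^ (d+k+2)
      + ((k : PowerSeries ℝ) + 1) * (1 + PowerSeries.X) ^ k * gs ^ (d+k+1)) * hg

lemma coeff_X_deriv (f : PowerSeries ℝ) (M : ℕ) :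
    PowerSeries.coeff M (PowerSeries.X * PowerSeries.derivative ℝ f) = M * PowerSeries.coeff M f := by
  rcases M with _ | M
  · simp
  · rw [PowerSeries.coeff_succ_X_mul, PowerSeries.coeff_derivative]
    push_cast; ring

lemma coeff_natCast_mul (n M : ℕ) (f : PowerSeries ℝ) :
    PowerSeries.coeff M ((n : PowerSeries ℝ) * f) = n * PowerSeries.coeff M f := by
  rw [← map_natCast (PowerSeries.C (R := ℝ)) n, PowerSeries.coeff_C_mul]

lemma fz_rec (d k M : ℕ) : ((k : ℝ) + d + 1) * PowerSeries.coeff M (fz d (k + 1)) =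
    k * PowerSeries.coeff M (fz d (k - 1)) + (2 * M + d + 1) * PowerSeries.coeff M (fz d k) := by
  have h := congrArg (PowerSeries.coeff (R := ℝ) M) (fz_deriv d k)
  have e1 : ((k : PowerSeries ℝ) + (d : PowerSeries ℝ) + 1) = ((k + d + 1 : ℕ) : PowerSeries ℝ) := by push_cast; rfl
  have e2 : ((d : PowerSeries ℝ) + 1) = ((d + 1 : ℕ) : PowerSeries ℝ) := by push_cast; rfl
  have e3 : (2 : PowerSeries ℝ) = ((2 : ℕ) : PowerSeries ℝ) := by push_cast; rfl
  rw [e1, e2, e3, map_add, map_add, coeff_natCast_mul, coeff_natCast_mul, coeff_natCast_mul,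
    coeff_natCast_mul, coeff_X_deriv] at h
  push_cast at h
  linear_combination h

/-- coefficients of `(1-x)^(-1/2)` -/
noncomputable def qc : ℕ → ℝ
  | 0 => 1
  | k + 1 => (k + 1 / 2) / (k + 1) * qc k

lemma qc_succ (k : ℕ) : ((k : ℝ) + 1) * qc (k + 1) = (k + 1 / 2) * qc k := by
  have : (k : ℝ) + 1 ≠ 0 := by positivity
  rw [qc]; field_simp

noncomputable def qs : PowerSeries ℝ := PowerSeries.mk qc

lemma qs_deriv : 2 * PowerSeries.derivative ℝ qs =
    2 * (PowerSeries.X * PowerSeries.derivative ℝ qs) + qs := by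
  ext n
  have e3 : (2 : PowerSeries ℝ) = ((2 : ℕ) : PowerSeries ℝ) := by push_cast; rfl
  rw [map_add, e3, coeff_natCast_mul, coeff_natCast_mul, coeff_X_deriv, PowerSeries.coeff_derivative]
  simp only [qs, PowerSeries.coeff_mk]
  have := qc_succ n
  push_cast
  linear_combination 2 * this

lemma qs_pow_deriv (d : ℕ) : 2 * PowerSeries.derivative ℝ (qs ^ d) =
    2 * (PowerSeries.X * PowerSeries.derivative ℝ (qs ^ d)) + (d : PowerSeries ℝ) * qs ^ d := by
  rw [PowerSeries.derivative_pow]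
  rcases d with _ | d
  · simp
  · simp only [Nat.add_sub_cancel]
    linear_combination ((d + 1 : ℕ) : PowerSeries ℝ) * qs ^ d * qs_deriv

lemma qs_pow_rec (d k : ℕ) : ((k : ℝ) + 1) * PowerSeries.coeff (k + 1) (qs ^ d) =
    (k + d / 2) * PowerSeries.coeff k (qs ^ d) := by
  have h := congrArg (PowerSeries.coeff (R := ℝ) k) (qs_pow_deriv d)
  have e3 : (2 : PowerSeries ℝ) = ((2 : ℕ) : PowerSeries ℝ) := by push_cast; rfl
  rw [map_add, e3, coeff_natCast_mul, coeff_natCast_mul, coeff_natCast_mul, coeff_X_deriv,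
    PowerSeries.coeff_derivative] at h
  push_cast at h
  linear_combination h / 2

lemma coeff_prod_pi {d : ℕ} (f : Fin d → PowerSeries ℝ) (n : ℕ) :
    PowerSeries.coeff n (∏ j, f j) =
      ∑ l ∈ Finset.piAntidiag Finset.univ n, ∏ j, PowerSeries.coeff (l j) (f j) := by
  rw [PowerSeries.coeff_prod]
  refine Finset.sum_bij' (fun l _ => (l : Fin d → ℕ)) (fun l _ => Finsupp.equivFunOnFinite.symm l)
    ?_ ?_ ?_ ?_ ?_
  · intro l hl; simpa using hl
  · intro l hl; simpa using hl
  · intro l hl; ext; simp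
  · intro l hl; ext; simp
  · intro l hl; rfl

lemma sum_le_coeff {d : ℕ} (f : Fin d → PowerSeries ℝ) (M : ℕ) :
    ∑ l ∈ Finset.filter (fun l => ∑ j, l j ≤ M)
      (Fintype.piFinset fun _ : Fin d => Finset.range (M + 1)),
      ∏ j, PowerSeries.coeff (l j) (f j) = PowerSeries.coeff M (gs * ∏ j, f j) := by
  rw [mul_comm, PowerSeries.coeff_mul, Finset.Nat.sum_antidiagonal_eq_sum_range_succ_mk]
  simp only [gs, PowerSeries.coeff_mk, Pi.one_apply, mul_one]
  simp only [coeff_prod_pi]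
  rw [← Finset.sum_fiberwise_of_maps_to (t := Finset.range M.succ) (g := fun l => ∑ j, l j)]
  · refine Finset.sum_congr rfl fun n hn => Finset.sum_congr ?_ fun _ _ => rfl
    ext l
    simp only [Finset.mem_filter, Fintype.mem_piFinset, Finset.mem_range, Finset.mem_piAntidiag,
      Finset.mem_univ, implies_true, and_true]
    simp only [Finset.mem_range] at hn
    constructor
    · exact fun h => h.2
    · intro h
      change ∑ j, l j = n at h
      refine ⟨⟨fun a => ?_, by omega⟩, h⟩
      have := Finset.single_le_sum (f := l) (fun i _ => Nat.zero_le _) (Finset.mem_univ a)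
      omega
  · intro l hl
    simp only [Finset.mem_filter] at hl
    simp only [Finset.mem_range]; omega

lemma prod_fz {d : ℕ} (κ : Fin d → ℕ) (k : ℕ) (h : ∑ j, κ j = k) :
    gs * ∏ j, fz 0 (κ j) = fz d k := by
  simp only [fz, Finset.prod_mul_distrib, Finset.prod_pow_eq_pow_sum, Finset.sum_add_distrib, h]
  simp
  ring

/-- combinatorial heart -/
lemma comb (d k M : ℕ) :
    ∑ l ∈ Finset.filter (fun l => ∑ j, l j ≤ M)
      (Fintype.piFinset fun _ : Fin d => Finset.range (M + 1)),
      ∑ κ ∈ Finset.piAntidiag (Finset.univ : Finset (Fin d)) k,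
        (Nat.multinomial Finset.univ κ : ℝ) *
          ∏ j, ((κ j).factorial * qc (κ j) * PowerSeries.coeff (l j) (fz 0 (κ j))) =
    k.factorial * PowerSeries.coeff k (qs ^ d) * PowerSeries.coeff M (fz d k) := by
  rw [Finset.sum_comm]
  have hq : qs ^ d = ∏ _j : Fin d, qs := by simp
  rw [hq, coeff_prod_pi, Finset.mul_sum, Finset.sum_mul]
  refine Finset.sum_congr rfl fun κ hκ => ?_
  simp only [Finset.mem_piAntidiag, Finset.mem_univ, implies_true, and_true] at hκ
  rw [← prod_fz κ k hκ, ← sum_le_coeff, Finset.mul_sum]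
  refine Finset.sum_congr rfl fun l _ => ?_
  have hm := Nat.multinomial_spec Finset.univ κ
  rw [hκ] at hm
  rw [← hm]
  simp only [Finset.prod_mul_distrib, qs, PowerSeries.coeff_mk]
  push_cast
  ring

end HZ

namespace HZ
open Polynomial

lemma intg (p : ℝ[X]) : Integrable (fun x : ℝ => p.eval x * Real.exp (-x ^ 2)) := by
  induction p using Polynomial.induction_on' with
  | add p q hp hq =>
    simp only [eval_add, add_mul]; exact hp.add hq
  | monomial n a =>
    have h := (integrable_rpow_mul_exp_neg_mul_sq (b := 1) one_pos (s := n)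
      (by have : (0:ℝ) ≤ n := n.cast_nonneg
          linarith)).const_mul a
    refine h.congr (Filter.Eventually.of_forall fun x => ?_)
    simp only [eval_monomial, Real.rpow_natCast]
    rw [show -(1:ℝ) * x ^ 2 = -x ^ 2 by ring]; ring

/-- Gaussian functional -/
noncomputable def gL (p : ℝ[X]) : ℝ := ∫ x : ℝ, p.eval x * Real.exp (-x ^ 2)

lemma gL_add (p q : ℝ[X]) : gL (p + q) = gL p + gL q := by
  simp only [gL, eval_add, add_mul]; exact integral_add (intg p) (intg q)

lemma gL_C_mul (a : ℝ) (p : ℝ[X]) : gL (C a * p) = a * gL p := by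
  simp only [gL, eval_mul, eval_C, mul_assoc]; exact integral_const_mul _ _

/-- linear version -/
noncomputable def gLl : ℝ[X] →ₗ[ℝ] ℝ where
  toFun := gL
  map_add' := gL_add
  map_smul' a p := by simp [smul_eq_C_mul, gL_C_mul]

lemma gL_parts (p : ℝ[X]) : gLl (derivative p) = gLl (C 2 * (X * p)) := by
  have h := integral_eq_zero_of_hasDerivAt_of_integrable
    (f := fun x : ℝ => p.eval x * Real.exp (-x ^ 2))
    (f' := fun x : ℝ => (derivative p + C (-1) * (C 2 * (X * p))).eval x * Real.exp (-x ^ 2))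
    (fun x => by
      have h1 := p.hasDerivAt x
      have h2 : HasDerivAt (fun x : ℝ => Real.exp (-x ^ 2)) (Real.exp (-x ^ 2) * (-(2 * x))) x := by
        have := ((hasDerivAt_pow 2 x).neg).exp
        simpa using this
      have := h1.mul h2
      convert! this using 1
      simp; ring) (intg _) (intg p)
  change gLl _ = 0 at h
  rw [map_add] at h
  have e : gLl (C (-1) * (C 2 * (X * p))) = -1 * gLl (C 2 * (X * p)) := gL_C_mul _ _
  rw [e] at h
  linarith

lemma gLl_C (a : ℝ) (p : ℝ[X]) : gLl (C a * p) = a * gLl p := gL_C_mul a p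

lemma gLl_one : gLl 1 = √π := by
  change gL 1 = _
  have := integral_gaussian 1
  simpa [gL] using this

/-- polynomial Hermite -/
noncomputable def hp : ℕ → ℝ[X]
  | 0 => 1
  | 1 => C 2 * X
  | (n + 2) => C 2 * X * hp (n + 1) - C (2 * ((n : ℝ) + 1)) * hp n

lemma hp_eval : ∀ (n : ℕ) (x : ℝ), (hp n).eval x = hermiteH n x
  | 0, x => by simp [hp, hermiteH]
  | 1, x => by simp [hp, hermiteH]
  | n + 2, x => by
    simp only [hp, hermiteH, eval_sub, eval_mul, eval_C, eval_X, hp_eval (n + 1) x, hp_eval n x]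

lemma hp_deriv : ∀ n : ℕ, derivative (hp (n + 1)) = C (2 * ((n : ℝ) + 1)) * hp n
  | 0 => by simp [hp]
  | 1 => by simp [hp, C_mul, C_add, C_ofNat]; ring
  | n + 2 => by
    have h1 := hp_deriv (n + 1)
    have h0 := hp_deriv n
    rw [hp]
    simp only [derivative_sub, derivative_mul, derivative_C, derivative_X, h1, h0]
    rw [hp]
    simp only [C_mul, C_add, C_ofNat, C_1, map_natCast]
    push_cast
    ring

lemma hp_succ (n : ℕ) : hp (n + 1) = C 2 * X * hp n - derivative (hp n) := by
  rcases n with _ | n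
  · simp [hp]
  · rw [hp, hp_deriv]

lemma hp_norm : ∀ n : ℕ, gLl (hp n * hp n) = 2 ^ n * n.factorial * √π
  | 0 => by simp [hp, gLl_one]
  | n + 1 => by
    have h := gL_parts (hp (n + 1) * hp n)
    rw [derivative_mul, map_add, hp_deriv] at h
    have e : hp (n + 1) * hp (n + 1)
        = C 2 * (X * (hp (n + 1) * hp n)) - hp (n + 1) * derivative (hp n) := by
      nth_rewrite 2 [hp_succ n]; ring
    rw [e, map_sub, ← h, mul_assoc (C _), gLl_C, hp_norm n, Nat.factorial_succ]
    push_cast; ring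

/-- even moments of the Hermite densities -/
lemma hp_ode (n : ℕ) : derivative (derivative (hp n)) =
    C 2 * (X * derivative (hp n)) - C (2 * (n : ℝ)) * hp n := by
  have h := hp_deriv n
  rw [hp_succ] at h
  simp only [derivative_sub, derivative_mul, derivative_C, derivative_X] at h
  simp only [C_mul, C_add, C_ofNat, C_1, map_natCast] at h ⊢
  linear_combination -h

lemma hA (n j : ℕ) : (j : ℝ) * gLl (X ^ (j - 1) * (hp n * hp n))
    + 2 * gLl (X ^ j * (hp n * derivative (hp n))) = 2 * gLl (X ^ (j + 1) * (hp n * hp n)) := by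
  have h := gL_parts (X ^ j * (hp n * hp n))
  rw [← gLl_C, ← gLl_C, ← gLl_C, ← map_add]
  convert! h using 2
  · simp only [derivative_mul, derivative_X_pow, C_ofNat]; ring
  · ring

lemma hC (n j : ℕ) : (j : ℝ) * gLl (X ^ (j - 1) * (hp n * derivative (hp n)))
    + gLl (X ^ j * (derivative (hp n) * derivative (hp n)))
      = 2 * n * gLl (X ^ j * (hp n * hp n)) := by
  have h := gL_parts (X ^ j * (hp n * derivative (hp n)))
  rw [← gLl_C, ← gLl_C, ← map_add]
  have e : derivative (X ^ j * (hp n * derivative (hp n))) =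
      (C (j : ℝ) * (X ^ (j - 1) * (hp n * derivative (hp n)))
        + X ^ j * (derivative (hp n) * derivative (hp n)))
      + C 2 * (X * (X ^ j * (hp n * derivative (hp n)))) - C (2 * (n : ℝ)) * (X ^ j * (hp n * hp n)) := by
    simp only [derivative_mul, derivative_X_pow, hp_ode]; ring
  rw [e, map_sub, map_add] at h
  linarith

lemma hD (n j : ℕ) : (j : ℝ) * gLl (X ^ (j - 1) * (derivative (hp n) * derivative (hp n)))
    + 2 * gLl (X ^ (j + 1) * (derivative (hp n) * derivative (hp n)))
      = 4 * n * gLl (X ^ j * (hp n * derivative (hp n))) := by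
  have h := gL_parts (X ^ j * (derivative (hp n) * derivative (hp n)))
  rw [← gLl_C, ← gLl_C, ← gLl_C, ← map_add]
  have e : derivative (X ^ j * (derivative (hp n) * derivative (hp n))) =
      (C (j : ℝ) * (X ^ (j - 1) * (derivative (hp n) * derivative (hp n)))
        + C 2 * (X ^ (j + 1) * (derivative (hp n) * derivative (hp n))))
      + C 2 * (X * (X ^ j * (derivative (hp n) * derivative (hp n))))
      - C (4 * (n : ℝ)) * (X ^ j * (hp n * derivative (hp n))) := by
    simp only [derivative_mul, derivative_X_pow, hp_ode]
    simp only [C_mul, C_ofNat, map_natCast]; ring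
  rw [e, map_sub, map_add] at h
  linarith

lemma hrecA (n k : ℕ) :
    8 * ((k : ℝ) + 1) * gLl (X ^ (2 * (k + 1)) * (hp n * hp n)) =
      4 * (2 * n + 1) * (2 * k + 1) * gLl (X ^ (2 * k) * (hp n * hp n))
      + (2 * k + 1) * (2 * k) * (2 * k - 1) * gLl (X ^ (2 * (k - 1)) * (hp n * hp n)) := by
  have d1 := hD n (2 * k + 1)
  have c1 := hC n (2 * k)
  have c2 := hC n (2 * k + 2)
  have a1 := hA n (2 * k + 1)
  have a2 := hA n (2 * k - 1)
  simp only [Nat.add_sub_cancel, show 2 * k + 2 - 1 = 2 * k + 1 by omega,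
    show 2 * k + 1 + 1 = 2 * k + 2 by omega] at d1 c1 c2 a1 a2
  rw [show 2 * (k + 1) = 2 * k + 2 by ring]
  rcases k with _ | k
  · push_cast at *
    simp only [mul_zero, zero_mul, zero_add] at *
    linear_combination -2 * d1 + 2 * c1 + 4 * c2 - (4 + 4 * n) * a1 - 0 * a2
  · simp only [show 2 * (k + 1) - 1 = 2 * k + 1 by omega, show 2 * k + 1 - 1 = 2 * k by omega,
      show 2 * k + 1 + 1 = 2 * (k + 1) by omega, show k + 1 - 1 = k by omega] at *
    push_cast at *
    linear_combination -2 * d1 + 2 * (2 * k + 3) * c1 + 4 * c2 - (4 * (k + 2) + 4 * n) * a1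
      - (2 * k + 3) * (2 * k + 2) * a2

end HZ

namespace HZ

lemma psi_sq (n : ℕ) (x : ℝ) : ψho n x ^ 2 =
    (2 ^ n * (n.factorial : ℝ) * √π)⁻¹ * ((hp n * hp n).eval x * Real.exp (-x ^ 2)) := by
  have h : (0 : ℝ) ≤ 2 ^ n * (n.factorial : ℝ) * √π := by positivity
  rw [ψho, mul_pow, mul_pow, inv_pow, Real.sq_sqrt h, Polynomial.eval_mul, hp_eval, ← Real.exp_nat_mul]
  rw [show ((2 : ℕ) : ℝ) * (-x ^ 2 / 2) = -x ^ 2 by push_cast; ring]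
  ring

lemma psi_int_aux (n k : ℕ) : (fun x : ℝ => x ^ (2 * k) * ψho n x ^ 2) =
    fun x => (2 ^ n * (n.factorial : ℝ) * √π)⁻¹ *
      ((Polynomial.X ^ (2 * k) * (hp n * hp n)).eval x * Real.exp (-x ^ 2)) := by
  ext x
  simp only [psi_sq, Polynomial.eval_mul, Polynomial.eval_pow, Polynomial.eval_X]; ring

lemma psi_integrable (n k : ℕ) : Integrable (fun x : ℝ => x ^ (2 * k) * ψho n x ^ 2) := by
  rw [psi_int_aux]; exact (intg _).const_mul _

lemma psi_integral (n k : ℕ) : ∫ x : ℝ, x ^ (2 * k) * ψho n x ^ 2 =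
    (2 ^ n * (n.factorial : ℝ) * √π)⁻¹ * gLl (Polynomial.X ^ (2 * k) * (hp n * hp n)) := by
  rw [psi_int_aux, integral_const_mul]; rfl

lemma psi_rec (n k : ℕ) :
    8 * ((k : ℝ) + 1) * (∫ x : ℝ, x ^ (2 * (k + 1)) * ψho n x ^ 2) =
      4 * (2 * n + 1) * (2 * k + 1) * (∫ x : ℝ, x ^ (2 * k) * ψho n x ^ 2)
      + (2 * k + 1) * (2 * k) * (2 * k - 1) * (∫ x : ℝ, x ^ (2 * (k - 1)) * ψho n x ^ 2) := by
  simp only [psi_integral]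
  linear_combination (2 ^ n * (n.factorial : ℝ) * √π)⁻¹ * hrecA n k

lemma psi_moment0 (n : ℕ) : ∫ x : ℝ, x ^ (2 * 0) * ψho n x ^ 2 = 1 := by
  rw [psi_integral, mul_zero, pow_zero, one_mul, hp_norm]
  have : (0 : ℝ) < 2 ^ n * (n.factorial : ℝ) * √π := by positivity
  exact inv_mul_cancel₀ this.ne'

lemma fz_zero (d M : ℕ) : PowerSeries.coeff M (fz d 0) = (Nat.choose (M + d) d : ℝ) := by
  rw [fz, pow_zero, one_mul, add_zero, gs, PowerSeries.mk_one_pow_eq_mk_choose_add,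
    PowerSeries.coeff_mk, add_comm]

lemma psi_moment (n k : ℕ) : ∫ x : ℝ, x ^ (2 * k) * ψho n x ^ 2 =
    k.factorial * qc k * PowerSeries.coeff n (fz 0 k) := by
  induction k using Nat.strong_induction_on with
  | _ k ih =>
    rcases k with _ | k
    · rw [psi_moment0, fz_zero]; simp [qc]
    · have h := psi_rec n k
      have hf := fz_rec 0 k n
      have hpos : (8 : ℝ) * ((k : ℝ) + 1) ≠ 0 := by positivity
      apply mul_left_cancel₀ hpos
      rw [h, ih k (by omega), ih (k - 1) (by omega), Nat.factorial_succ]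
      have q1 := qc_succ k
      push_cast at hf ⊢
      have q2 : (k : ℝ) * (k.factorial * qc k) =
          k * ((k - 1 / 2) * ((k - 1).factorial * qc (k - 1))) := by
        rcases k with _ | k
        · simp
        · have := qc_succ k
          rw [Nat.factorial_succ, Nat.add_sub_cancel]
          push_cast
          linear_combination ((k : ℝ) + 1) * k.factorial * this
      linear_combination -8 * ((k : ℝ) + 1) * k.factorial * PowerSeries.coeff n (fz 0 (k + 1)) * q1
        - 8 * (k.factorial : ℝ) * (k + 1 / 2) * qc k * hf
        - 8 * ((k : ℝ) + 1 / 2) * PowerSeries.coeff n (fz 0 (k - 1)) * q2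

lemma total (d k M : ℕ) : ∫ x : EuclideanSpace ℝ (Fin d), ‖x‖ ^ (2 * k) * fermiDensity d M x =
    k.factorial * PowerSeries.coeff k (qs ^ d) * PowerSeries.coeff M (fz d k) := by
  rw [← comb]
  have h1 := (EuclideanSpace.volume_preserving_symm_measurableEquiv_toLp (Fin d)).symm.integral_comp'
    (g := fun x : EuclideanSpace ℝ (Fin d) => ‖x‖ ^ (2 * k) * fermiDensity d M x)
  rw [← h1]
  have h2 : ∀ y : Fin d → ℝ,
      ‖(MeasurableEquiv.toLp 2 (Fin d → ℝ)).symm.symm y‖ ^ (2 * k)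
        * fermiDensity d M ((MeasurableEquiv.toLp 2 (Fin d → ℝ)).symm.symm y) =
      ∑ l ∈ Finset.filter (fun l => ∑ j, l j ≤ M)
        (Fintype.piFinset fun _ : Fin d => Finset.range (M + 1)),
        ∑ κ ∈ Finset.piAntidiag (Finset.univ : Finset (Fin d)) k,
        (Nat.multinomial Finset.univ κ : ℝ) * ∏ j, (y j ^ (2 * κ j) * ψho (l j) (y j) ^ 2) := by
    intro y
    rw [pow_mul, EuclideanSpace.norm_sq_eq]
    simp only [Real.norm_eq_abs, sq_abs]
    rw [Finset.sum_pow_eq_sum_piAntidiag, fermiDensity, Finset.mul_sum]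
    refine Finset.sum_congr rfl fun l _ => ?_
    rw [Finset.sum_mul]
    refine Finset.sum_congr rfl fun κ _ => ?_
    rw [Finset.prod_mul_distrib, mul_assoc]
    simp only [pow_mul]
    rfl
  have hint : ∀ (l κ : Fin d → ℕ), Integrable (fun y : Fin d → ℝ =>
      (Nat.multinomial Finset.univ κ : ℝ) * ∏ j, (y j ^ (2 * κ j) * ψho (l j) (y j) ^ 2)) :=
    fun l κ => (Integrable.fintype_prod (f := fun j (t : ℝ) => t ^ (2 * κ j) * ψho (l j) t ^ 2)
      (fun j => psi_integrable _ _)).const_mul _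
  simp only [h2]
  rw [integral_finsetSum _ fun l _ => integrable_finsetSum _ fun κ _ => hint l κ]
  refine Finset.sum_congr rfl fun l _ => ?_
  rw [integral_finsetSum _ fun κ _ => hint l κ]
  refine Finset.sum_congr rfl fun κ _ => ?_
  rw [integral_const_mul,
    integral_fintype_prod_volume_eq_prod (f := fun j (t : ℝ) => t ^ (2 * κ j) * ψho (l j) t ^ 2)]
  simp only [psi_moment]

lemma total_rec (d k M : ℕ) (S : ℕ → ℝ)
    (hS : ∀ k, S k = k.factorial * PowerSeries.coeff k (qs ^ d) * PowerSeries.coeff M (fz d k)) :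
    ((k : ℝ) + d + 1) * S (k + 1) = k * (k + d / 2) * (k + d / 2 - 1) * S (k - 1)
      + (2 * k + d) * ((M + (d + 1) / 2) * S k) := by
  have hf := fz_rec d k M
  have q1 := qs_pow_rec d k
  rw [hS, hS, hS]
  set c := fun k => PowerSeries.coeff k (qs ^ d) with hc
  set f := fun k => PowerSeries.coeff M (fz d k) with hf'
  change ((k : ℝ) + 1) * c (k + 1) = (k + d / 2) * c k at q1
  change ((k : ℝ) + d + 1) * f (k + 1) = k * f (k - 1) + (2 * M + d + 1) * f k at hf
  change ((k : ℝ) + d + 1) * ((k + 1).factorial * c (k + 1) * f (k + 1)) =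
    k * (k + d / 2) * (k + d / 2 - 1) * ((k - 1).factorial * c (k - 1) * f (k - 1))
      + (2 * k + d) * ((M + (d + 1) / 2) * (k.factorial * c k * f k))
  have q2 : (k : ℝ) * (k.factorial * c k) = k * ((k + d / 2 - 1) * ((k - 1).factorial * c (k - 1))) := by
    rcases k with _ | k
    · simp
    · have := qs_pow_rec d k
      change ((k : ℝ) + 1) * c (k + 1) = (k + d / 2) * c k at this
      rw [Nat.factorial_succ, Nat.add_sub_cancel]
      push_cast
      linear_combination ((k : ℝ) + 1) * k.factorial * this
  rw [Nat.factorial_succ]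
  push_cast
  linear_combination (k.factorial : ℝ) * (k + d + 1) * f (k + 1) * q1
    + (k.factorial : ℝ) * (k + d / 2) * c k * hf + (k + d / 2) * f (k - 1) * q2

lemma rhs_rec (d : ℕ) (μ : ℤ → ℤ → ℝ)
    (hb : ∀ k l : ℤ, (k < 0 ∨ l < 0 ∨ l > k / 2) → μ k l = 0)
    (hrec : ∀ k l : ℤ, 0 ≤ k →
      ((k : ℝ) + (d : ℝ) + 1) * μ (k + 1) l =
        (k : ℝ) * ((k : ℝ) + (d : ℝ) / 2) * ((k : ℝ) + (d : ℝ) / 2 - 1) * μ (k - 1) (l - 1) +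
          (2 * (k : ℝ) + (d : ℝ)) * μ k l) (t : ℝ) (T : ℕ → ℝ)
    (hT : ∀ k : ℕ, T k = ∑ l ∈ Finset.range (k / 2 + 1), t ^ (k - 2 * l) * μ (k : ℤ) (l : ℤ))
    (k : ℕ) :
    ((k : ℝ) + d + 1) * T (k + 1) = k * (k + d / 2) * (k + d / 2 - 1) * T (k - 1)
      + (2 * k + d) * (t * T k) := by
  have hext : ∀ j N : ℕ, j / 2 + 1 ≤ N →
      T j = ∑ l ∈ Finset.range N, t ^ (j - 2 * l) * μ (j : ℤ) (l : ℤ) := by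
    intro j N h
    rw [hT]
    refine Finset.sum_subset (by simpa using h) fun l _ hl => ?_
    rw [hb _ _ (Or.inr (Or.inr ?_)), mul_zero]
    simp only [Finset.mem_range] at hl
    omega
  rw [hext (k + 1) (k + 2) (by omega), hext k (k + 2) (by omega), hext (k - 1) (k + 1) (by omega)]
  have e1 : t * ∑ l ∈ Finset.range (k + 2), t ^ (k - 2 * l) * μ (k : ℤ) (l : ℤ) =
      ∑ l ∈ Finset.range (k + 2), t ^ (k + 1 - 2 * l) * μ (k : ℤ) (l : ℤ) := by
    rw [Finset.mul_sum]
    refine Finset.sum_congr rfl fun l _ => ?_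
    by_cases h : 2 * l ≤ k
    · rw [show k + 1 - 2 * l = (k - 2 * l) + 1 by omega, pow_succ]; ring
    · rw [hb _ _ (Or.inr (Or.inr (by omega)))]; ring
  have e2 : (k : ℝ) * ∑ l ∈ Finset.range (k + 1), t ^ (k - 1 - 2 * l) * μ ((k - 1 : ℕ) : ℤ) (l : ℤ) =
      k * ∑ l ∈ Finset.range (k + 2), t ^ (k + 1 - 2 * l) * μ ((k : ℤ) - 1) ((l : ℤ) - 1) := by
    rcases k with _ | k
    · simp
    · rw [Finset.sum_range_succ' _ (k + 1 + 1)]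
      rw [hb _ (((0 : ℕ) : ℤ) - 1) (by right; left; norm_num)]
      simp only [mul_zero, add_zero]
      congr 1
      refine Finset.sum_congr rfl fun l _ => ?_
      rw [show k + 1 - 1 - 2 * l = k + 1 + 1 - 2 * (l + 1) by omega]
      congr 2
      · push_cast; ring
      · push_cast; ring
  rw [e1]
  have e3 : ∀ A : ℝ, (k : ℝ) * (k + d / 2) * (k + d / 2 - 1) * A =
    (k + d / 2) * (k + d / 2 - 1) * (k * A) := fun A => by ring
  rw [e3, e2, ← e3, Finset.mul_sum, Finset.mul_sum, Finset.mul_sum, ← Finset.sum_add_distrib]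
  refine Finset.sum_congr rfl fun l _ => ?_
  have h := hrec k l (by positivity)
  push_cast at h ⊢
  linear_combination t ^ (k + 1 - 2 * l) * h

end HZ

/-- with `μ^{(d)}` the unique family satisfying the generalised Harer–Zagier
recurrence with the stated initial and boundary conditions, the moments admit the
expansion `m_{2k} = Σ_{l=0}^{⌊k/2⌋} M̃^{k-2l} μ^{(d)}_{k,l}` with `M̃ = M + (d+1)/2`. -/
theorem fermi_moment_HarerZagier_expansion (d : ℕ) (hd : 1 ≤ d)
    (μ : ℤ → ℤ → ℝ)
    (h0 : μ 0 0 = 1)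
    (hb : ∀ k l : ℤ, (k < 0 ∨ l < 0 ∨ l > k / 2) → μ k l = 0)
    (hrec : ∀ k l : ℤ, 0 ≤ k →
      ((k : ℝ) + (d : ℝ) + 1) * μ (k + 1) l =
        (k : ℝ) * ((k : ℝ) + (d : ℝ) / 2) * ((k : ℝ) + (d : ℝ) / 2 - 1) * μ (k - 1) (l - 1) +
          (2 * (k : ℝ) + (d : ℝ)) * μ k l) :
    ∀ M k : ℕ,
      (1 / (Nat.choose (M + d) d : ℝ)) *
          ∫ x : EuclideanSpace ℝ (Fin d), ‖x‖ ^ (2 * k) * fermiDensity d M x =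
        ∑ l ∈ Finset.range (k / 2 + 1),
          ((M : ℝ) + ((d : ℝ) + 1) / 2) ^ (k - 2 * l) * μ (k : ℤ) (l : ℤ) := by
  intro M k
  have hN : (Nat.choose (M + d) d : ℝ) ≠ 0 := by
    exact_mod_cast (Nat.choose_pos (Nat.le_add_left d M)).ne'
  rw [one_div, inv_mul_eq_iff_eq_mul₀ hN, HZ.total]
  have hS := HZ.total_rec d (M := M) (S := fun k => k.factorial * PowerSeries.coeff k (HZ.qs ^ d) *
    PowerSeries.coeff M (HZ.fz d k)) (hS := fun _ => rfl)
  have hT := HZ.rhs_rec d μ hb hrec ((M : ℝ) + ((d : ℝ) + 1) / 2)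
    (fun k => ∑ l ∈ Finset.range (k / 2 + 1),
          ((M : ℝ) + ((d : ℝ) + 1) / 2) ^ (k - 2 * l) * μ (k : ℤ) (l : ℤ)) (fun _ => rfl)
  induction k using Nat.strong_induction_on with
  | _ k ih =>
    rcases k with _ | k
    · rw [HZ.fz_zero]
      simp [h0, HZ.qs, HZ.qc]
    · have hpos : (k : ℝ) + d + 1 ≠ 0 := by positivity
      apply mul_left_cancel₀ hpos
      have hSk := hS k
      have hTk := hT k
      beta_reduce at hSk hTk
      linear_combination hSk - (Nat.choose (M + d) d : ℝ) * hTk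
        + k * (k + d / 2) * (k + d / 2 - 1) * ih (k - 1) (by omega)
        + (2 * k + d) * (M + (d + 1) / 2) * ih k (by omega)
end

section
/- Fix an integer d ≥ 1, and let μ^{(d)} : ℤ × ℤ → ℝ be the unique family satisfying μ^{(d)}_{0,0} = 1, μ^{(d)}_{k,l} = 0 whenever k < 0 or l < 0 or l > ⌊k/2⌋, and (k+d+1) μ^{(d)}_{k+1,l} = k (k + d/2)(k + d/2 - 1) μ^{(d)}_{k-1,l-1} + (2k + d) μ^{(d)}_{k,l} for all k ≥ 0. Then for every integer k ≥ 0 one has μ^{(d)}_{k,1} = μ^{(d)}_{k,0} · k (k-1)(2k + 3d - 1)/24. -/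
open MeasureTheory Real

/-- for the Harer–Zagier family `μ^{(d)}`,
`μ^{(d)}_{k,1} = μ^{(d)}_{k,0} · k(k-1)(2k+3d-1)/24`. -/
theorem HarerZagier_subleading_coefficient (d : ℕ) (hd : 1 ≤ d)
    (μ : ℤ → ℤ → ℝ)
    (h0 : μ 0 0 = 1)
    (hb : ∀ k l : ℤ, (k < 0 ∨ l < 0 ∨ l > k / 2) → μ k l = 0)
    (hrec : ∀ k l : ℤ, 0 ≤ k →
      ((k : ℝ) + (d : ℝ) + 1) * μ (k + 1) l =
        (k : ℝ) * ((k : ℝ) + (d : ℝ) / 2) * ((k : ℝ) + (d : ℝ) / 2 - 1) * μ (k - 1) (l - 1) +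
          (2 * (k : ℝ) + (d : ℝ)) * μ k l) :
    ∀ k : ℕ, μ (k : ℤ) 1 =
      μ (k : ℤ) 0 * ((k : ℝ) * ((k : ℝ) - 1) * (2 * (k : ℝ) + 3 * (d : ℝ) - 1) / 24) := by
  intro k
  have hz : ∀ k : ℕ, ((k : ℝ) + d + 1) * μ ((k : ℤ) + 1) 0 = (2 * (k : ℝ) + d) * μ k 0 := by
    intro k
    have h := hrec k 0 (by positivity)
    rw [hb ((k : ℤ) - 1) (0 - 1) (by right; left; norm_num)] at h
    push_cast at h
    linarith
  induction k with
  | zero =>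
    rw [hb _ 1 (by right; right; norm_num)]
    simp
  | succ k ih =>
    have h1 := hrec k 1 (by positivity)
    have h2 := hz k
    have hne : ((k : ℝ) + d + 1) ≠ 0 := by positivity
    apply mul_left_cancel₀ hne
    have h3 : (k : ℝ) * ((k : ℝ) + d / 2) * ((k : ℝ) + d / 2 - 1) * μ ((k : ℤ) - 1) 0
        = (k : ℝ) * (2 * k + d) * (k + d) / 4 * μ k 0 := by
      cases k with
      | zero => simp
      | succ j =>
        have h4 := hz j
        push_cast at h4 ⊢
        have e : ((j : ℤ) + 1 - 1) = j := by ring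
        rw [e]
        linear_combination (-((j : ℝ) + 1) * (2 * (j + 1) + d) / 4) * h4
    push_cast at h1 ih ⊢
    rw [h3, ih] at h1
    linear_combination h1 - (((k : ℝ) + 1) * k * (2 * (k + 1) + 3 * d - 1) / 24) * h2
end
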